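/- arXiv:1208.4202 — 7 statements merged into one kernel-verified Lean document; each statement's English description precedes it below -/
import Mathlib

section
/- Let H be a monoid with quotient group G. Then the following are equivalent: (a) there is no overmonoid H' of H (a submonoid of G containing H) with H ⊊ H' and aH'b ⊆ H for some a,b ∈ H; (b) (𝔞 :ₗ 𝔞) = H for every non-empty subset 𝔞 ⊆ G with H𝔞 = 𝔞 and 𝔞d ⊆ H for some d ∈ H, and (𝔟 :ᵣ 𝔟) = H for every non-empty subset 𝔟 ⊆ G with 𝔟H = 𝔟 and c𝔟 ⊆ H for some c ∈ H; (c) (𝔞 :ₗ 𝔞) = (𝔞 :ᵣ 𝔞) = H for every non-empty ideal 𝔞 of H. -/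
open scoped Pointwise

/-- `H` is a submonoid of the group `G` such that `G` is a left and a right
quotient group of `H` (i.e. `H` is a cancellative semigroup satisfying both
Ore conditions, embedded in its quotient group `G = q(H)`). -/
def IsQG {G : Type*} [Group G] (H : Submonoid G) : Prop :=
  (∀ g : G, ∃ a ∈ H, ∃ b ∈ H, g = a⁻¹ * b) ∧ (∀ g : G, ∃ c ∈ H, ∃ d ∈ H, g = c * d⁻¹)

/-- Left quotient `(A :ₗ B) = {x ∈ G | x B ⊆ A}`. -/
def lq {G : Type*} [Group G] (A B : Set G) : Set G := {x | ∀ b ∈ B, x * b ∈ A}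

/-- Right quotient `(A :ᵣ B) = {x ∈ G | B x ⊆ A}`. -/
def rq {G : Type*} [Group G] (A B : Set G) : Set G := {x | ∀ b ∈ B, b * x ∈ A}

/-- A fractional ideal of `H`: a two-sided `H`-module `𝔞 ⊆ G = q(H)` with
`c𝔞 ⊆ H` and `𝔞d ⊆ H` for some `c, d ∈ H`. -/
def IsFracIdeal {G : Type*} [Group G] (H : Submonoid G) (a : Set G) : Prop :=
  (H : Set G) * a = a ∧ a * (H : Set G) = a ∧
  (∃ c ∈ H, ∀ x ∈ a, c * x ∈ H) ∧ (∃ d ∈ H, ∀ x ∈ a, x * d ∈ H)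

/-- An ideal of `H`: a two-sided `H`-module contained in `H`. -/
def IsIdeal {G : Type*} [Group G] (H : Submonoid G) (a : Set G) : Prop :=
  a ⊆ (H : Set G) ∧ (H : Set G) * a = a ∧ a * (H : Set G) = a

/-- The divisorial closure `𝔞_v = (H :ₗ (H :ᵣ 𝔞))`. -/
def vOp {G : Type*} [Group G] (H : Submonoid G) (a : Set G) : Set G :=
  lq (H : Set G) (rq (H : Set G) a)

/-- `H` is completely integrally closed:
`(𝔞 :ₗ 𝔞) = (𝔞 :ᵣ 𝔞) = H` for every non-empty ideal `𝔞` of `H`. -/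
def IsCIC {G : Type*} [Group G] (H : Submonoid G) : Prop :=
  ∀ a : Set G, IsIdeal H a → a.Nonempty → lq a a = (H : Set G) ∧ rq a a = (H : Set G)

/-- The left multiplier set `(𝔞 :ₗ 𝔞)` as a submonoid. -/
def lqSubmonoid {G : Type*} [Group G] (a : Set G) : Submonoid G where
  carrier := lq a a
  one_mem' b hb := by simpa using hb
  mul_mem' {x y} hx hy b hb := by
    rw [mul_assoc]
    exact hx _ (hy b hb)

/-- The right multiplier set `(𝔞 :ᵣ 𝔞)` as a submonoid. -/
def rqSubmonoid {G : Type*} [Group G] (a : Set G) : Submonoid G where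
  carrier := rq a a
  one_mem' b hb := by simpa using hb
  mul_mem' {x y} hx hy b hb := by
    rw [← mul_assoc]
    exact hy _ (hx b hb)

theorem Submonoid.coe_mul_eq_of_forall_mem {G : Type*} [Group G] {H : Submonoid G} {s : Set G}
    (h : ∀ x ∈ H, ∀ y ∈ s, x * y ∈ s) : (H : Set G) * s = s :=
  (Set.mul_subset_iff.2 h).antisymm fun y hy => ⟨1, H.one_mem, y, hy, one_mul y⟩

theorem Submonoid.mul_coe_eq_of_forall_mem {G : Type*} [Group G] {H : Submonoid G} {s : Set G}
    (h : ∀ y ∈ s, ∀ x ∈ H, y * x ∈ s) : s * (H : Set G) = s :=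
  (Set.mul_subset_iff.2 h).antisymm fun y hy => ⟨y, hy, 1, H.one_mem, mul_one y⟩

/-- If all left multiplier sets of ideals are trivial, a two-sided bound on an overmonoid
improves to a one-sided bound. -/
theorem mul_mem_of_forall_mul_mul_mem {G : Type*} [Group G] {H H' : Submonoid G}
    (hc : ∀ I : Set G, IsIdeal H I → I.Nonempty → lq I I = (H : Set G)) (hle : H ≤ H')
    {a b : G} (ha : a ∈ H) (hb : b ∈ H) (hab : ∀ y ∈ H', a * y * b ∈ H) :
    ∀ y ∈ H', a * y ∈ H := by
  intro y hy
  let I : Set G := {x | x ∈ H ∧ ∀ z ∈ H', a * z * x ∈ H}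
  have hI : IsIdeal H I := by
    refine ⟨fun x hx => hx.1, Submonoid.coe_mul_eq_of_forall_mem ?_,
      Submonoid.mul_coe_eq_of_forall_mem ?_⟩
    · rintro h hh x ⟨hx, hx'⟩
      refine ⟨mul_mem hh hx, fun z hz => ?_⟩
      simpa only [mul_assoc] using hx' (z * h) (mul_mem hz (hle hh))
    · rintro x ⟨hx, hx'⟩ h hh
      refine ⟨mul_mem hx hh, fun z hz => ?_⟩
      simpa only [mul_assoc] using mul_mem (hx' z hz) hh
  have hmem : a * y ∈ lq I I := by
    rintro x ⟨-, hx'⟩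
    refine ⟨hx' y hy, fun z hz => ?_⟩
    simpa only [mul_assoc] using hx' (z * (a * y)) (mul_mem hz (mul_mem (hle ha) hy))
  rwa [hc I hI ⟨b, hb, hab⟩] at hmem

/-- If all right multiplier sets of ideals are trivial, an overmonoid with a one-sided bound
is trivial. -/
theorem le_of_forall_mul_mem {G : Type*} [Group G] {H H' : Submonoid G}
    (hc : ∀ I : Set G, IsIdeal H I → I.Nonempty → rq I I = (H : Set G)) (hle : H ≤ H')
    {a : G} (ha : ∀ y ∈ H', a * y ∈ H) : H' ≤ H := by
  intro y hy
  let J : Set G := {x | ∀ z ∈ H', x * z ∈ H}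
  have hJ' : ∀ x ∈ J, ∀ z ∈ H', x * z ∈ J := fun x hx z hz w hw => by
    simpa only [mul_assoc] using hx (z * w) (mul_mem hz hw)
  have hJ : IsIdeal H J := by
    refine ⟨fun x hx => by simpa using hx 1 H'.one_mem, Submonoid.coe_mul_eq_of_forall_mem ?_,
      Submonoid.mul_coe_eq_of_forall_mem fun x hx z hz => hJ' x hx z (hle hz)⟩
    intro h hh x hx z hz
    simpa only [mul_assoc] using mul_mem hh (hx z hz)
  have hmem : y ∈ rq J J := fun x hx => hJ' x hx y hy
  rwa [hc J hJ ⟨a, ha⟩] at hmem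

/-- Characterizations of being completely integrally closed:
(a) no proper overmonoid `H'` of `H` (inside `G = q(H)`) satisfies `aH'b ⊆ H`
for some `a, b ∈ H`;
(b) `(𝔞 :ₗ 𝔞) = H` for every non-empty left module `𝔞` which is right
`H`-fractional, and `(𝔟 :ᵣ 𝔟) = H` for every non-empty right module `𝔟` which
is left `H`-fractional;
(c) `(𝔞 :ₗ 𝔞) = (𝔞 :ᵣ 𝔞) = H` for every non-empty ideal `𝔞` of `H`. -/
theorem stmt2 {G : Type*} [Group G] (H : Submonoid G) (hq : IsQG H) :
    [¬ ∃ H' : Submonoid G, H < H' ∧ ∃ a ∈ H, ∃ b ∈ H,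
        ({a} : Set G) * (H' : Set G) * {b} ⊆ (H : Set G),
     (∀ a : Set G, a.Nonempty → (H : Set G) * a = a → (∃ d ∈ H, ∀ x ∈ a, x * d ∈ H) →
        lq a a = (H : Set G)) ∧
     (∀ b : Set G, b.Nonempty → b * (H : Set G) = b → (∃ c ∈ H, ∀ x ∈ b, c * x ∈ H) →
        rq b b = (H : Set G)),
     ∀ a : Set G, IsIdeal H a → a.Nonempty →
        lq a a = (H : Set G) ∧ rq a a = (H : Set G)].TFAE := by
  tfae_have 1 → 2 := by
    intro h
    refine ⟨?_, ?_⟩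
    · rintro s ⟨x, hx⟩ hs ⟨d, hd, hsd⟩
      have hle : H ≤ lqSubmonoid s := fun y hy z hz => hs ▸ Set.mul_mem_mul hy hz
      by_contra hne
      refine h ⟨lqSubmonoid s, lt_of_le_of_ne hle fun e => hne (congrArg SetLike.coe e).symm,
        1, H.one_mem, x * d, hsd x hx, ?_⟩
      rintro _ ⟨_, ⟨_, rfl, y, hy, rfl⟩, _, rfl, rfl⟩
      simpa [mul_assoc] using hsd _ (hy x hx)
    · rintro s ⟨x, hx⟩ hs ⟨c, hc, hsc⟩
      have hle : H ≤ rqSubmonoid s := fun y hy z hz => hs ▸ Set.mul_mem_mul hz hy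
      by_contra hne
      refine h ⟨rqSubmonoid s, lt_of_le_of_ne hle fun e => hne (congrArg SetLike.coe e).symm,
        c * x, hsc x hx, 1, H.one_mem, ?_⟩
      rintro _ ⟨_, ⟨_, rfl, y, hy, rfl⟩, _, rfl, rfl⟩
      simpa [mul_assoc] using hsc _ (hy x hx)
  tfae_have 2 → 3 := by
    rintro ⟨hl, hr⟩ s ⟨hsH, hHs, hsH'⟩ hne
    exact ⟨hl s hne hHs ⟨1, H.one_mem, fun x hx => by simpa using hsH hx⟩,
      hr s hne hsH' ⟨1, H.one_mem, fun x hx => by simpa using hsH hx⟩⟩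
  tfae_have 3 → 1 := by
    rintro hc ⟨H', hlt, a, ha, b, hb, hab⟩
    have hab' : ∀ y ∈ H', a * y * b ∈ H := fun y hy =>
      hab (Set.mul_mem_mul (Set.mul_mem_mul rfl hy) rfl)
    exact hlt.not_ge (le_of_forall_mul_mem (fun I hI hne => (hc I hI hne).2) hlt.le
      (mul_mem_of_forall_mul_mul_mem (fun I hI hne => (hc I hI hne).1) hlt.le ha hb hab'))
  tfae_finish
end

section
/- Let H be a completely integrally closed monoid with quotient group G. Then for every non-empty fractional ideal 𝔞 of H one has (H :ₗ 𝔞) = (H :ᵣ 𝔞) and (H :ₗ (H :ᵣ 𝔞)) = (H :ᵣ (H :ₗ 𝔞)). -/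
open scoped Pointwise

theorem mul_coe_eq_iff {G : Type*} [Group G] (H : Submonoid G) (a : Set G) :
    a * (H : Set G) = a ↔ ∀ x ∈ a, ∀ h ∈ H, x * h ∈ a := by
  constructor
  · intro e x hx h hh
    rw [← e]
    exact Set.mul_mem_mul hx hh
  · intro e
    refine Set.Subset.antisymm (Set.mul_subset_iff.2 e) fun x hx => ?_
    exact ⟨x, hx, 1, H.one_mem, mul_one x⟩

theorem coe_mul_eq_iff {G : Type*} [Group G] (H : Submonoid G) (a : Set G) :
    (H : Set G) * a = a ↔ ∀ h ∈ H, ∀ x ∈ a, h * x ∈ a := by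
  constructor
  · intro e h hh x hx
    rw [← e]
    exact Set.mul_mem_mul hh hx
  · intro e
    refine Set.Subset.antisymm (Set.mul_subset_iff.2 e) fun x hx => ?_
    exact ⟨1, H.one_mem, x, hx, one_mul x⟩

/-- The left multiplier monoid `(𝔞 :ₗ 𝔞)` of a non-empty fractional ideal lies in `H`:
it stabilises the non-empty ideal `(H :ᵣ (𝔞 :ₗ 𝔞))`. -/
theorem IsCIC.lq_self_subset {G : Type*} [Group G] {H : Submonoid G} (hcic : IsCIC H)
    {a : Set G} (ha : IsFracIdeal H a) (hne : a.Nonempty) : lq a a ⊆ (H : Set G) := by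
  obtain ⟨hl, -, -, d, -, hd⟩ := ha
  rw [coe_mul_eq_iff] at hl
  obtain ⟨y, hy⟩ := hne
  have hstab : ∀ z ∈ lq a a, ∀ x ∈ rq (H : Set G) (lq a a), z * x ∈ rq (H : Set G) (lq a a) := by
    intro z hz x hx w hw
    rw [← mul_assoc]
    exact hx _ fun b hb => by rw [mul_assoc]; exact hw _ (hz b hb)
  have hideal : IsIdeal H (rq (H : Set G) (lq a a)) := by
    refine ⟨fun x hx => ?_, (coe_mul_eq_iff H _).2 fun h hh => hstab h (hl h hh),
      (mul_coe_eq_iff H _).2 fun x hx h hh w hw => ?_⟩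
    · simpa using hx 1 fun b hb => by simpa using hb
    · rw [← mul_assoc]
      exact H.mul_mem (hx w hw) hh
  have hmem : y * d ∈ rq (H : Set G) (lq a a) := fun w hw => by
    rw [← mul_assoc]
    exact hd _ (hw y hy)
  rw [← (hcic _ hideal ⟨_, hmem⟩).1]
  exact hstab

/-- The right multiplier monoid `(𝔞 :ᵣ 𝔞)` of a non-empty fractional ideal lies in `H`:
it stabilises the non-empty ideal `(H :ₗ (𝔞 :ᵣ 𝔞))`. -/
theorem IsCIC.rq_self_subset {G : Type*} [Group G] {H : Submonoid G} (hcic : IsCIC H)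
    {a : Set G} (ha : IsFracIdeal H a) (hne : a.Nonempty) : rq a a ⊆ (H : Set G) := by
  obtain ⟨-, hr, ⟨c, -, hc⟩, -⟩ := ha
  rw [mul_coe_eq_iff] at hr
  obtain ⟨y, hy⟩ := hne
  have hstab : ∀ z ∈ rq a a, ∀ x ∈ lq (H : Set G) (rq a a), x * z ∈ lq (H : Set G) (rq a a) := by
    intro z hz x hx w hw
    rw [mul_assoc]
    exact hx _ fun b hb => by rw [← mul_assoc]; exact hw _ (hz b hb)
  have hideal : IsIdeal H (lq (H : Set G) (rq a a)) := by
    refine ⟨fun x hx => ?_, (coe_mul_eq_iff H _).2 fun h hh x hx w hw => ?_,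
      (mul_coe_eq_iff H _).2 fun x hx h hh => hstab h (fun b hb => hr b hb h hh) x hx⟩
    · simpa using hx 1 fun b hb => by simpa using hb
    · rw [mul_assoc]
      exact H.mul_mem hh (hx w hw)
  have hmem : c * y ∈ lq (H : Set G) (rq a a) := fun w hw => by
    rw [mul_assoc]
    exact hc _ (hw y hy)
  rw [← (hcic _ hideal ⟨_, hmem⟩).2]
  exact hstab

theorem IsCIC.lq_eq_rq {G : Type*} [Group G] {H : Submonoid G} (hcic : IsCIC H)
    {a : Set G} (ha : IsFracIdeal H a) (hne : a.Nonempty) :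
    lq (H : Set G) a = rq (H : Set G) a := by
  have hl := (coe_mul_eq_iff H a).1 ha.1
  have hr := (mul_coe_eq_iff H a).1 ha.2.1
  refine Set.Subset.antisymm (fun x hx y hy => ?_) fun x hx y hy => ?_
  · refine hcic.lq_self_subset ha hne fun z hz => ?_
    rw [mul_assoc]
    exact hr y hy _ (hx z hz)
  · refine hcic.rq_self_subset ha hne fun z hz => ?_
    rw [← mul_assoc]
    exact hl _ (hx z hz) y hy

/-- If the left and right inverses of a non-empty fractional ideal agree, then the inverse
is again a fractional ideal. -/
theorem IsFracIdeal.rq {G : Type*} [Group G] {H : Submonoid G} (hq : IsQG H) {a : Set G}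
    (ha : IsFracIdeal H a) (hne : a.Nonempty) (e : lq (H : Set G) a = rq (H : Set G) a) :
    IsFracIdeal H (rq (H : Set G) a) := by
  have hr := (mul_coe_eq_iff H a).1 ha.2.1
  obtain ⟨y, hy⟩ := hne
  obtain ⟨c, hc, d, hd, rfl⟩ := hq.2 y
  have hca : c ∈ a := by simpa using hr _ hy d hd
  refine ⟨(coe_mul_eq_iff H _).2 fun h hh x hx w hw => ?_,
    (mul_coe_eq_iff H _).2 fun x hx h hh w hw => ?_, ⟨c, hc, fun x hx => hx c hca⟩,
    ⟨c, hc, fun x hx => ?_⟩⟩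
  · rw [← mul_assoc]
    exact hx _ (hr w hw h hh)
  · rw [← mul_assoc]
    exact H.mul_mem (hx w hw) hh
  · rw [← e] at hx
    exact hx c hca

/-- In a completely integrally closed monoid `H`, for every non-empty fractional
ideal `𝔞` one has `(H :ₗ 𝔞) = (H :ᵣ 𝔞)` and
`(H :ₗ (H :ᵣ 𝔞)) = (H :ᵣ (H :ₗ 𝔞))`. -/
theorem stmt3 {G : Type*} [Group G] (H : Submonoid G) (hq : IsQG H) (hcic : IsCIC H) :
    ∀ a : Set G, IsFracIdeal H a → a.Nonempty →
      lq (H : Set G) a = rq (H : Set G) a ∧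
      lq (H : Set G) (rq (H : Set G) a) = rq (H : Set G) (lq (H : Set G) a) := by
  intro a ha hne
  have e := hcic.lq_eq_rq ha hne
  obtain ⟨d, -, hd⟩ := ha.2.2.2
  refine ⟨e, ?_⟩
  rw [e]
  exact hcic.lq_eq_rq (ha.rq hq hne e) ⟨d, hd⟩
end

section
/- Let H be a completely integrally closed monoid. Then the set I_v^*(H) of v-invertible divisorial ideals of H is closed under v-multiplication, contains H as unit element, and v-multiplication is commutative on it: for all 𝔞,𝔟 ∈ I_v^*(H) one has (𝔞𝔟)_v = (𝔟𝔞)_v ∈ I_v^*(H). -/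
open scoped Pointwise

/-- A divisorial ideal (v-ideal) of `H`: an ideal with `𝔞 = 𝔞_v`. -/
def IsDivIdeal {G : Type*} [Group G] (H : Submonoid G) (a : Set G) : Prop :=
  IsIdeal H a ∧ a = vOp H a

/-- A prime ideal of `H`: a proper ideal `𝔭` such that `aHb ⊆ 𝔭` implies
`a ∈ 𝔭` or `b ∈ 𝔭`. -/
def IsPrimeIdeal {G : Type*} [Group G] (H : Submonoid G) (p : Set G) : Prop :=
  IsIdeal H p ∧ p ≠ (H : Set G) ∧
  ∀ a ∈ H, ∀ b ∈ H, ({a} : Set G) * (H : Set G) * {b} ⊆ p → a ∈ p ∨ b ∈ p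

/-- A v-maximal v-ideal of `H`: a maximal element (under inclusion) of the set
of divisorial ideals of `H` distinct from `H`. -/
def IsVMax {G : Type*} [Group G] (H : Submonoid G) (m : Set G) : Prop :=
  IsDivIdeal H m ∧ m ≠ (H : Set G) ∧
  ∀ b : Set G, IsDivIdeal H b → b ≠ (H : Set G) → m ⊆ b → b = m

/-- A v-invertible divisorial ideal of `H`: a divisorial ideal `𝔞` with
`𝔞 ·_v 𝔞⁻¹ = 𝔞⁻¹ ·_v 𝔞 = H`, where `𝔞⁻¹ = (H : 𝔞)`. -/
def IsVInv {G : Type*} [Group G] (H : Submonoid G) (a : Set G) : Prop :=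
  IsDivIdeal H a ∧
  vOp H (a * lq (H : Set G) a) = (H : Set G) ∧
  vOp H (lq (H : Set G) a * a) = (H : Set G)

section TotalPreorder

variable {α : Type*} [Group α] [Preorder α]

theorem exists_pow_le_and_le_pow_succ (total : ∀ u v : α, u ≤ v ∨ v ≤ u) {z a : α}
    (hz : 1 ≤ z) (ha : 1 ≤ a) {k : ℕ} (hk : z ≤ a ^ k) :
    ∃ m : ℕ, a ^ m ≤ z ∧ z ≤ a ^ (m + 1) := by
  induction k with
  | zero => exact ⟨0, by simpa using hz, hk.trans (by simpa using ha)⟩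
  | succ k ih =>
    rcases total z (a ^ k) with h | h
    · exact ih h
    · exact ⟨k, h, hk⟩

variable [MulLeftMono α] [MulRightMono α]

/-- In a preordered group, `x ^ n * d ^ n ≤ (x * d) ^ n` if `x * d ≤ d * x`. -/
theorem pow_mul_pow_le_mul_pow {x d : α} (h : x * d ≤ d * x) (n : ℕ) :
    x ^ n * d ^ n ≤ (x * d) ^ n := by
  induction n with
  | zero => simp
  | succ n ih =>
    calc x ^ (n + 1) * d ^ (n + 1) = x * (x ^ n * d ^ n) * d := by
          rw [pow_succ', pow_succ]; group
      _ ≤ x * (d * x) ^ n * d := by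
          gcongr
          exact ih.trans (pow_le_pow_left' h n)
      _ = (x * d) ^ (n + 1) := by
          rw [pow_succ, ← mul_assoc, (SemiconjBy.pow_right (show SemiconjBy x (d * x) (x * d) by
            simp [SemiconjBy, mul_assoc]) n).eq, mul_assoc]

/-- In a preordered group, `d ^ n * x ^ n ≤ (x * d) ^ n` if `d * x ≤ x * d`. -/
theorem pow_mul_pow_le_mul_pow_swap {x d : α} (h : d * x ≤ x * d) (n : ℕ) :
    d ^ n * x ^ n ≤ (x * d) ^ n :=
  (pow_mul_pow_le_mul_pow h n).trans (pow_le_pow_left' h n)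

/-- If `x ^ n` and `y ^ n` lie in the same interval `[a ^ m, a ^ (m + 1)]`, then
`(x⁻¹ * y) ^ n ≤ a`. -/
theorem inv_mul_pow_le_of_pow_mem_Icc (total : ∀ u v : α, u ≤ v ∨ v ≤ u) {x y a : α} {n m : ℕ}
    (hx : a ^ m ≤ x ^ n) (hy : y ^ n ≤ a ^ (m + 1)) : (x⁻¹ * y) ^ n ≤ a := by
  have hxy : x * (x⁻¹ * y) = y := mul_inv_cancel_left x y
  rcases total (x * (x⁻¹ * y)) (x⁻¹ * y * x) with h | h
  · have key : x ^ n * (x⁻¹ * y) ^ n ≤ x ^ n * a := calc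
      _ ≤ y ^ n := by simpa only [hxy] using pow_mul_pow_le_mul_pow h n
      _ ≤ a ^ m * a := by rwa [← pow_succ]
      _ ≤ x ^ n * a := by gcongr
    exact le_of_mul_le_mul_left' key
  · have key : (x⁻¹ * y) ^ n * x ^ n ≤ a * x ^ n := calc
      _ ≤ y ^ n := by simpa only [hxy] using pow_mul_pow_le_mul_pow_swap h n
      _ ≤ a * a ^ m := by rwa [← pow_succ']
      _ ≤ a * x ^ n := by gcongr
    exact le_of_mul_le_mul_right' key

/-- In a totally preordered group, the powers of the commutator of `x` and `a` with
`1 ≤ x ≤ a` are bounded by `a`. -/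
theorem commutator_pow_le (total : ∀ u v : α, u ≤ v ∨ v ≤ u) {x a : α}
    (hx : 1 ≤ x) (hxa : x ≤ a) (n : ℕ) :
    (x⁻¹ * (a⁻¹ * x * a)) ^ n ≤ a ∧ ((a⁻¹ * x * a)⁻¹ * x) ^ n ≤ a := by
  obtain ⟨m, h₁, h₂⟩ := exists_pow_le_and_le_pow_succ total (one_le_pow_of_one_le' hx n)
    (hx.trans hxa) (pow_le_pow_left' hxa n)
  have hy : (a⁻¹ * x * a) ^ n = a⁻¹ * x ^ n * a := by
    simpa using conj_pow (a := a⁻¹) (b := x) (i := n)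
  have hconj (k : ℕ) : a⁻¹ * a ^ k * a = a ^ k := by
    rw [mul_assoc, ← pow_succ, pow_succ', inv_mul_cancel_left]
  refine ⟨inv_mul_pow_le_of_pow_mem_Icc total h₁ ?_, inv_mul_pow_le_of_pow_mem_Icc total ?_ h₂⟩
  · rw [hy, ← hconj (m + 1)]; gcongr
  · rw [hy, ← hconj m]; gcongr

end TotalPreorder

section LatticeGroup

variable {L : Type*} [Group L] [Lattice L]

/-- Every bounded above non-empty subset has a supremum. -/
def HasBoundedSups (L : Type*) [Lattice L] : Prop :=
  ∀ s : Set L, s.Nonempty → BddAbove s → ∃ b, IsLUB s b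

theorem one_le_left_of_inf_eq_one {a b : L} (h : a ⊓ b = 1) : 1 ≤ a := h ▸ inf_le_left

theorem one_le_right_of_inf_eq_one {a b : L} (h : a ⊓ b = 1) : 1 ≤ b := h ▸ inf_le_right

theorem inf_eq_one_of_le {a b c : L} (h : a ⊓ b = 1) (hc : 1 ≤ c) (hcb : c ≤ b) : a ⊓ c = 1 :=
  le_antisymm ((inf_le_inf_left a hcb).trans h.le) (le_inf (one_le_left_of_inf_eq_one h) hc)

/-- A filter of elements `> 1` that decides, for every `h ≥ 1`, whether `h` belongs to it or
is disjoint from one of its members. -/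
theorem exists_maximal_filter {g : L} (hg : 1 < g) :
    ∃ U : Set L, g ∈ U ∧ (∀ u ∈ U, ∀ v ∈ U, u ⊓ v ∈ U) ∧ (∀ u ∈ U, 1 < u) ∧
      ∀ h, 1 ≤ h → h ∈ U ∨ ∃ v ∈ U, h ⊓ v = 1 := by
  obtain ⟨U, hgU, ⟨⟨hinf, hlt⟩, hmax⟩⟩ := zorn_subset_nonempty
    {U : Set L | (∀ u ∈ U, ∀ v ∈ U, u ⊓ v ∈ U) ∧ ∀ u ∈ U, 1 < u}
    (by
      intro c hc hchain hne
      refine ⟨⋃₀ c, ⟨?_, ?_⟩, fun s hs => Set.subset_sUnion_of_mem hs⟩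
      · rintro u ⟨s, hs, hu⟩ v ⟨t, ht, hv⟩
        rcases hchain.total hs ht with hst | hts
        · exact ⟨t, ht, (hc ht).1 u (hst hu) v hv⟩
        · exact ⟨s, hs, (hc hs).1 u hu v (hts hv)⟩
      · rintro u ⟨s, hs, hu⟩
        exact (hc hs).2 u hu)
    {g} (by simpa using hg)
  have hgU : g ∈ U := hgU rfl
  refine ⟨U, hgU, hinf, hlt, fun h hh => ?_⟩
  by_contra! hcon
  obtain ⟨hhU, hne⟩ := hcon
  refine hhU (hmax (y := {w | ∃ v ∈ U, h ⊓ v ≤ w}) ⟨?_, ?_⟩ ?_ ⟨g, hgU, inf_le_left⟩)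
  · rintro u ⟨v, hv, hu⟩ u' ⟨v', hv', hu'⟩
    exact ⟨v ⊓ v', hinf v hv v' hv', le_inf
      ((inf_le_inf_left h inf_le_left).trans hu) ((inf_le_inf_left h inf_le_right).trans hu')⟩
  · rintro u ⟨v, hv, hu⟩
    exact (lt_of_le_of_ne (le_inf hh (hlt v hv).le) (hne v hv).symm).trans_le hu
  · exact fun v hv => ⟨v, hv, inf_le_right⟩

variable [MulLeftMono L]

theorem le_one_of_le_mul_inv {s e : L} (h : s ≤ s * e⁻¹) : e ≤ 1 := by
  simpa using h

variable [MulRightMono L]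

theorem inf_mul_eq_one {a b c : L} (hb : a ⊓ b = 1) (hc : a ⊓ c = 1) : a ⊓ (b * c) = 1 := by
  have ha := one_le_left_of_inf_eq_one hb
  have hb' := one_le_right_of_inf_eq_one hb
  refine le_antisymm ?_ (le_inf ha (one_le_mul hb' (one_le_right_of_inf_eq_one hc)))
  rw [← hb]
  refine le_inf inf_le_left ?_
  calc a ⊓ b * c ≤ b * a ⊓ b * c := inf_le_inf_right _ (le_mul_of_one_le_left' hb')
    _ = b := by rw [← mul_inf, hc, mul_one]

theorem inf_pow_eq_one {a b : L} (h : a ⊓ b = 1) (n : ℕ) : a ⊓ b ^ n = 1 := by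
  induction n with
  | zero => simpa using one_le_left_of_inf_eq_one h
  | succ n ih => rw [pow_succ]; exact inf_mul_eq_one ih h

/-- Disjoint elements multiply to their supremum. -/
theorem mul_eq_sup_of_inf_eq_one {a b : L} (h : a ⊓ b = 1) : a * b = a ⊔ b := by
  have : a * (a ⊓ b)⁻¹ * b = a ⊔ b := by
    rw [inv_inf, mul_sup, sup_mul]; simp [sup_comm]
  simpa [h] using this

theorem commute_of_inf_eq_one {a b : L} (h : a ⊓ b = 1) : a * b = b * a := by
  rw [mul_eq_sup_of_inf_eq_one h, mul_eq_sup_of_inf_eq_one (inf_comm a b ▸ h), sup_comm]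

theorem conj_inf (x a b : L) : x * (a ⊓ b) * x⁻¹ = x * a * x⁻¹ ⊓ x * b * x⁻¹ := by
  rw [mul_inf, inf_mul]

theorem conj_oneLePart (x a : L) : (x * a * x⁻¹)⁺ᵐ = x * a⁺ᵐ * x⁻¹ := by
  simp only [oneLePart, mul_sup, sup_mul, mul_one, mul_inv_cancel]

theorem le_one_of_pow_le (hL : HasBoundedSups L) {c d : L} (h : ∀ n : ℕ, d ^ n ≤ c) : d ≤ 1 := by
  obtain ⟨s, hs⟩ := hL (Set.range (d ^ · : ℕ → L)) (Set.range_nonempty _)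
    ⟨c, by rintro _ ⟨n, rfl⟩; exact h n⟩
  refine le_one_of_le_mul_inv (hs.2 ?_)
  rintro _ ⟨n, rfl⟩
  rw [le_mul_inv_iff_mul_le]
  exact hs.1 ⟨n + 1, pow_succ d n⟩

/-- Decomposition of `x` along the polar of `b`. -/
theorem exists_polar_decomposition (hL : HasBoundedSups L) {x b : L} (hx : 1 ≤ x) (hb : 1 ≤ b) :
    ∃ s t : L, x = s * t ∧ t ⊓ b = 1 ∧ ∀ a, a ⊓ b = 1 → a ⊓ s = 1 := by
  obtain ⟨s, hs⟩ := hL (Set.range fun n : ℕ => x ⊓ b ^ n) (Set.range_nonempty _)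
    ⟨x, by rintro _ ⟨n, rfl⟩; exact inf_le_left⟩
  have hle (n : ℕ) : x ⊓ b ^ n ≤ s := hs.1 ⟨n, rfl⟩
  have hone (n : ℕ) : 1 ≤ x ⊓ b ^ n := le_inf hx (one_le_pow_of_one_le' hb n)
  have hsx : s ≤ x := hs.2 (by rintro _ ⟨n, rfl⟩; exact inf_le_left)
  have le_one_of {e : L} (he : ∀ n, (x ⊓ b ^ n) * e ≤ s) : e ≤ 1 :=
    le_one_of_le_mul_inv (hs.2 (by
      rintro _ ⟨n, rfl⟩
      exact le_mul_inv_iff_mul_le.2 (he n)))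
  refine ⟨s, s⁻¹ * x, by simp, ?_, fun a ha => ?_⟩
  · refine le_antisymm (le_one_of fun n => ?_) (le_inf (by simpa using hsx) hb)
    refine le_trans (le_inf ?_ ?_) (hle (n + 1))
    · calc _ ≤ s * (s⁻¹ * x) := mul_le_mul' (hle n) inf_le_left
        _ = x := by simp
    · calc _ ≤ b ^ n * b := mul_le_mul' inf_le_right inf_le_right
        _ = b ^ (n + 1) := (pow_succ b n).symm
  · have ha1 := one_le_left_of_inf_eq_one ha
    have hs1 := (hone 0).trans (hle 0)
    refine le_antisymm (le_one_of fun n => ?_) (le_inf ha1 hs1)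
    have hdisj : (x ⊓ b ^ n) ⊓ (a ⊓ s) = 1 := by
      have h₁ := inf_eq_one_of_le (inf_pow_eq_one ha n) (hone n) inf_le_right
      exact inf_eq_one_of_le (by rwa [inf_comm]) (le_inf ha1 hs1) inf_le_left
    rw [mul_eq_sup_of_inf_eq_one hdisj]
    exact sup_le (hle n) inf_le_right

theorem inv_conj_inf_eq_one_of_one_le (hL : HasBoundedSups L) {a b x : L} (h : a ⊓ b = 1)
    (hx : 1 ≤ x) : x⁻¹ * a * x ⊓ b = 1 := by
  obtain ⟨s, t, rfl, htb, hs⟩ :=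
    exists_polar_decomposition hL hx (one_le_right_of_inf_eq_one h)
  have has : s⁻¹ * a * s = a := by
    rw [mul_assoc, commute_of_inf_eq_one (hs a h), inv_mul_cancel_left]
  have htb' : t⁻¹ * b * t = b := by
    rw [mul_assoc, ← commute_of_inf_eq_one htb, inv_mul_cancel_left]
  have := conj_inf t⁻¹ a b
  rw [inv_inv, h, htb'] at this
  rw [show (s * t)⁻¹ * a * (s * t) = t⁻¹ * (s⁻¹ * a * s) * t by group, has, ← this]
  simp

/-- Conjugation preserves disjointness in a conditionally complete lattice-ordered group. -/
theorem conj_inf_eq_one (hL : HasBoundedSups L) {a b : L} (h : a ⊓ b = 1) (x : L) :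
    x * a * x⁻¹ ⊓ b = 1 := by
  have hpos {a b y : L} (h : a ⊓ b = 1) (hy : 1 ≤ y) : y * a * y⁻¹ ⊓ b = 1 := by
    have := conj_inf y a (y⁻¹ * b * y)
    rw [inf_comm a, inv_conj_inf_eq_one_of_one_le hL (inf_comm a b ▸ h) hy] at this
    simpa [mul_assoc] using this.symm
  have := hpos (inv_conj_inf_eq_one_of_one_le hL h (one_le_leOnePart x)) (one_le_oneLePart x)
  rw [← oneLePart_div_leOnePart x]
  simpa [div_eq_mul_inv, mul_assoc] using this

/-- A conditionally complete lattice-ordered group has enough total preorders. -/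
theorem exists_total_preorder (hL : HasBoundedSups L) {g : L} (hg : ¬ g ≤ 1) :
    ∃ r : L → L → Prop, (∀ a b c, r a b → r b c → r a c) ∧
      (∀ a b c, r a b → r (c * a) (c * b)) ∧ (∀ a b c, r a b → r (a * c) (b * c)) ∧
      (∀ a b, r a b ∨ r b a) ∧ (∀ a b, a ≤ b → r a b) ∧ ¬ r g 1 := by
  have hg' : 1 < g⁺ᵐ :=
    lt_of_le_of_ne (one_le_oneLePart g) fun h => hg (oneLePart_eq_one.1 h.symm)
  obtain ⟨U, hgU, hinf, hlt, hdec⟩ := exists_maximal_filter hg'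
  let Q : L → Prop := fun h => ∃ v ∈ U, v ⊓ h⁺ᵐ = 1
  have Q_of_le {h : L} (hh : h ≤ 1) : Q h :=
    ⟨_, hgU, by rw [oneLePart_eq_one.2 hh]; exact inf_eq_right.2 hg'.le⟩
  have Q_mul {h k : L} (hh : Q h) (hk : Q k) : Q (h * k) := by
    obtain ⟨v, hv, hvh⟩ := hh
    obtain ⟨w, hw, hwk⟩ := hk
    have hvw := (hlt _ (hinf v hv w hw)).le
    refine ⟨v ⊓ w, hinf v hv w hw, ?_⟩
    have h₁ : (v ⊓ w) ⊓ h⁺ᵐ = 1 := by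
      rw [inf_comm] at hvh ⊢; exact inf_eq_one_of_le hvh hvw inf_le_left
    have h₂ : (v ⊓ w) ⊓ k⁺ᵐ = 1 := by
      rw [inf_comm] at hwk ⊢; exact inf_eq_one_of_le hwk hvw inf_le_right
    refine inf_eq_one_of_le (inf_mul_eq_one h₁ h₂) (one_le_oneLePart _) ?_
    exact sup_le (mul_le_mul' (le_oneLePart h) (le_oneLePart k))
      (one_le_mul (one_le_oneLePart h) (one_le_oneLePart k))
  have Q_conj {h : L} (hh : Q h) (x : L) : Q (x * h * x⁻¹) := by
    obtain ⟨v, hv, hvh⟩ := hh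
    refine ⟨v, hv, ?_⟩
    rw [conj_oneLePart, inf_comm]
    exact conj_inf_eq_one hL (inf_comm v _ ▸ hvh) x
  have Q_total (h : L) : Q h ∨ Q h⁻¹ := by
    rcases hdec _ (one_le_oneLePart h) with hU | ⟨v, hv, hvh⟩
    · exact .inr ⟨_, hU, by rw [oneLePart_inv]; exact oneLePart_inf_leOnePart_eq_one h⟩
    · exact .inl ⟨v, hv, by rwa [inf_comm]⟩
  refine ⟨fun a b => Q (a * b⁻¹), fun a b c hab hbc => by simpa using Q_mul hab hbc,
    fun a b c h => by simpa [mul_assoc] using Q_conj h c, fun a b c h => by simpa using h,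
    fun a b => by simpa using Q_total (a * b⁻¹), fun a b h => Q_of_le (by simpa using h), ?_⟩
  rintro ⟨v, hv, hvg⟩
  rw [inv_one, mul_one] at hvg
  exact (hlt _ (hinf v hv _ hgU)).ne' hvg

theorem commutator_pow_le_sup (hL : HasBoundedSups L) {a x : L} (ha : 1 ≤ a) (hx : 1 ≤ x) (n : ℕ) :
    (x⁻¹ * (a⁻¹ * x * a)) ^ n ≤ a ⊔ x := by
  by_contra hcon
  rw [← mul_inv_le_one_iff_le] at hcon
  obtain ⟨r, htrans, hleft, hright, total, hext, hnot⟩ := exists_total_preorder hL hcon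
  refine hnot ?_
  have key : r ((x⁻¹ * (a⁻¹ * x * a)) ^ n) (a ⊔ x) := by
    have bound {x a : L} (hx : 1 ≤ x) (hxa : r x a) :
        r ((x⁻¹ * (a⁻¹ * x * a)) ^ n) a ∧ r (((a⁻¹ * x * a)⁻¹ * x) ^ n) a :=
      @commutator_pow_le L _
        { le := r, lt := fun a b => r a b ∧ ¬ r b a, lt_iff_le_not_ge := fun _ _ => Iff.rfl,
          le_refl := fun a => hext a a le_rfl, le_trans := htrans }
        ⟨fun c a b h => hleft a b c h⟩ ⟨fun c a b h => hright a b c h⟩ total x a (hext 1 x hx) hxa n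
    rcases total x a with h | h
    · exact htrans _ _ _ (bound hx h).1 (hext _ _ le_sup_left)
    · refine htrans _ _ _ ?_ (hext _ _ le_sup_right)
      simpa [mul_assoc] using (bound ha h).2
  simpa using hright _ _ (a ⊔ x)⁻¹ key

/-- Positive elements of a conditionally complete lattice-ordered group commute. -/
theorem mul_comm_of_one_le (hL : HasBoundedSups L) {a x : L} (ha : 1 ≤ a) (hx : 1 ≤ x) :
    a * x = x * a := by
  have key {a x : L} (ha : 1 ≤ a) (hx : 1 ≤ x) : x * a ≤ a * x := by
    have := le_one_of_pow_le hL (commutator_pow_le_sup hL ha hx)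
    rwa [inv_mul_le_one_iff, mul_assoc, inv_mul_le_iff_le_mul] at this
  exact le_antisymm (key hx ha) (key ha hx)

end LatticeGroup

section VIdeals

variable {G : Type*} [Group G] {H : Submonoid G} {A B : Set G}

theorem lq_anti_right (S : Set G) (h : A ⊆ B) : lq S B ⊆ lq S A := fun _ hx b hb => hx b (h hb)

theorem rq_anti_right (S : Set G) (h : A ⊆ B) : rq S B ⊆ rq S A := fun _ hx b hb => hx b (h hb)

theorem vOp_mono (h : A ⊆ B) : vOp H A ⊆ vOp H B := lq_anti_right _ (rq_anti_right _ h)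

theorem subset_vOp (H : Submonoid G) (A : Set G) : A ⊆ vOp H A := fun a ha _ hx => hx a ha

theorem rq_vOp (H : Submonoid G) (A : Set G) : rq (H : Set G) (vOp H A) = rq (H : Set G) A :=
  (rq_anti_right _ (subset_vOp H A)).antisymm fun x hx _ hy => hy x hx

theorem vOp_vOp (H : Submonoid G) (A : Set G) : vOp H (vOp H A) = vOp H A :=
  congrArg (lq (H : Set G)) (rq_vOp H A)

theorem lq_mul (S A B : Set G) : lq S (A * B) = lq (lq S B) A := by
  ext x
  refine ⟨fun h a ha b hb => ?_, ?_⟩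
  · rw [mul_assoc]; exact h _ (Set.mul_mem_mul ha hb)
  · rintro h _ ⟨a, ha, b, hb, rfl⟩
    simpa [mul_assoc] using h a ha b hb

theorem rq_mul (S A B : Set G) : rq S (A * B) = rq (rq S A) B := by
  ext x
  refine ⟨fun h b hb a ha => ?_, ?_⟩
  · rw [← mul_assoc]; exact h _ (Set.mul_mem_mul ha hb)
  · rintro h _ ⟨a, ha, b, hb, rfl⟩
    simpa [mul_assoc] using h b hb a ha

theorem lq_coe_self (H : Submonoid G) : lq (H : Set G) H = H :=
  Set.Subset.antisymm (fun x hx => by simpa using hx 1 H.one_mem) fun _ hx _ hy => H.mul_mem hx hy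

theorem rq_coe_self (H : Submonoid G) : rq (H : Set G) H = H :=
  Set.Subset.antisymm (fun x hx => by simpa using hx 1 H.one_mem) fun _ hx _ hy => H.mul_mem hy hx

theorem vOp_coe (H : Submonoid G) : vOp H (H : Set G) = H := by
  rw [vOp, rq_coe_self, lq_coe_self]

theorem vOp_vOp_mul (H : Submonoid G) (A B : Set G) : vOp H (vOp H A * B) = vOp H (A * B) := by
  rw [vOp, rq_mul, rq_vOp, ← rq_mul, ← vOp]

variable (H A) in
/-- A non-empty two-sided `H`-submodule of `G` with non-empty left and right quotients:
a non-empty fractional ideal. -/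
structure IsNonemptyFrac : Prop where
  mul_mem_left : ∀ h ∈ H, ∀ x ∈ A, h * x ∈ A
  mul_mem_right : ∀ h ∈ H, ∀ x ∈ A, x * h ∈ A
  nonempty : A.Nonempty
  lq_nonempty : (lq (H : Set G) A).Nonempty
  rq_nonempty : (rq (H : Set G) A).Nonempty

namespace IsNonemptyFrac

theorem coe_mul (hA : IsNonemptyFrac H A) : (H : Set G) * A = A := by
  refine Set.Subset.antisymm ?_ fun x hx => ⟨1, H.one_mem, x, hx, one_mul x⟩
  rintro _ ⟨h, hh, x, hx, rfl⟩
  exact hA.mul_mem_left h hh x hx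

theorem mul_coe (hA : IsNonemptyFrac H A) : A * (H : Set G) = A := by
  refine Set.Subset.antisymm ?_ fun x hx => ⟨x, hx, 1, H.one_mem, mul_one x⟩
  rintro _ ⟨x, hx, h, hh, rfl⟩
  exact hA.mul_mem_right h hh x hx

theorem isIdeal (hA : IsNonemptyFrac H A) (h : A ⊆ H) : IsIdeal H A := ⟨h, hA.coe_mul, hA.mul_coe⟩

theorem of_isIdeal (hA : IsIdeal H A) (hne : A.Nonempty) : IsNonemptyFrac H A where
  mul_mem_left _ hh _ hx := hA.2.1 ▸ Set.mul_mem_mul hh hx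
  mul_mem_right _ hh _ hx := hA.2.2 ▸ Set.mul_mem_mul hx hh
  nonempty := hne
  lq_nonempty := ⟨1, fun x hx => by simpa using hA.1 hx⟩
  rq_nonempty := ⟨1, fun x hx => by simpa using hA.1 hx⟩

theorem coe (H : Submonoid G) : IsNonemptyFrac H (H : Set G) :=
  of_isIdeal ⟨subset_rfl, by simp, by simp⟩ ⟨1, H.one_mem⟩

theorem mul (hA : IsNonemptyFrac H A) (hB : IsNonemptyFrac H B) : IsNonemptyFrac H (A * B) where
  mul_mem_left := by
    rintro h hh _ ⟨a, ha, b, hb, rfl⟩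
    exact ⟨h * a, hA.mul_mem_left h hh a ha, b, hb, mul_assoc h a b⟩
  mul_mem_right := by
    rintro h hh _ ⟨a, ha, b, hb, rfl⟩
    exact ⟨a, ha, b * h, hB.mul_mem_right h hh b hb, (mul_assoc a b h).symm⟩
  nonempty := hA.nonempty.mul hB.nonempty
  lq_nonempty := by
    obtain ⟨c, hc⟩ := hA.lq_nonempty
    obtain ⟨d, hd⟩ := hB.lq_nonempty
    refine ⟨d * c, ?_⟩
    rintro _ ⟨a, ha, b, hb, rfl⟩
    simpa [mul_assoc] using hd _ (hB.mul_mem_left _ (hc a ha) b hb)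
  rq_nonempty := by
    obtain ⟨c, hc⟩ := hA.rq_nonempty
    obtain ⟨d, hd⟩ := hB.rq_nonempty
    refine ⟨d * c, ?_⟩
    rintro _ ⟨a, ha, b, hb, rfl⟩
    simpa [mul_assoc] using hc _ (hA.mul_mem_right _ (hd b hb) a ha)

theorem lq_self (hcic : IsCIC H) (hA : IsNonemptyFrac H A) : lq A A = H := by
  refine Set.Subset.antisymm (fun x hx => ?_) fun h hh a ha => hA.mul_mem_left h hh a ha
  have hI : IsIdeal H (A * rq (H : Set G) A) := by
    refine ⟨?_, by rw [← mul_assoc, hA.coe_mul], ?_⟩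
    · rintro _ ⟨a, ha, b, hb, rfl⟩
      exact hb a ha
    · refine Set.Subset.antisymm ?_ fun x hx => ⟨x, hx, 1, H.one_mem, mul_one x⟩
      rintro _ ⟨_, ⟨a, ha, b, hb, rfl⟩, h, hh, rfl⟩
      refine ⟨a, ha, b * h, fun y hy => ?_, (mul_assoc a b h).symm⟩
      simpa [mul_assoc] using H.mul_mem (hb y hy) hh
  rw [← (hcic _ hI (hA.nonempty.mul hA.rq_nonempty)).1]
  rintro _ ⟨a, ha, b, hb, rfl⟩
  exact ⟨x * a, hx a ha, b, hb, mul_assoc x a b⟩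

theorem rq_self (hcic : IsCIC H) (hA : IsNonemptyFrac H A) : rq A A = H := by
  refine Set.Subset.antisymm (fun x hx => ?_) fun h hh a ha => hA.mul_mem_right h hh a ha
  have hI : IsIdeal H (lq (H : Set G) A * A) := by
    refine ⟨?_, ?_, by rw [mul_assoc, hA.mul_coe]⟩
    · rintro _ ⟨b, hb, a, ha, rfl⟩
      exact hb a ha
    · refine Set.Subset.antisymm ?_ fun x hx => ⟨1, H.one_mem, x, hx, one_mul x⟩
      rintro _ ⟨h, hh, _, ⟨b, hb, a, ha, rfl⟩, rfl⟩
      refine ⟨h * b, fun y hy => ?_, a, ha, mul_assoc h b a⟩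
      simpa [mul_assoc] using H.mul_mem hh (hb y hy)
  rw [← (hcic _ hI (hA.lq_nonempty.mul hA.nonempty)).2]
  rintro _ ⟨b, hb, a, ha, rfl⟩
  exact ⟨b, hb, a * x, hx a ha, (mul_assoc b a x).symm⟩

theorem lq_eq_rq (hcic : IsCIC H) (hA : IsNonemptyFrac H A) :
    lq (H : Set G) A = rq (H : Set G) A := by
  refine Set.Subset.antisymm (fun x hx a ha => ?_) fun x hx a ha => ?_
  · rw [← hA.lq_self hcic]
    intro b hb
    rw [mul_assoc]
    exact hA.mul_mem_right _ (hx b hb) a ha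
  · rw [← hA.rq_self hcic]
    intro b hb
    rw [← mul_assoc]
    exact hA.mul_mem_left _ (hx b hb) a ha

theorem leftQuotient (hcic : IsCIC H) (hA : IsNonemptyFrac H A) : IsNonemptyFrac H (lq (H : Set G) A) where
  mul_mem_left h hh x hx a ha := by simpa [mul_assoc] using H.mul_mem hh (hx a ha)
  mul_mem_right h hh x hx a ha := by
    simpa [mul_assoc] using hx _ (hA.mul_mem_left h hh a ha)
  nonempty := hA.lq_nonempty
  lq_nonempty := by
    rw [hA.lq_eq_rq hcic]
    exact hA.nonempty.mono fun a ha x hx => hx a ha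
  rq_nonempty := hA.nonempty.mono fun a ha x hx => hx a ha

theorem closure (hcic : IsCIC H) (hA : IsNonemptyFrac H A) : IsNonemptyFrac H (vOp H A) := by
  rw [vOp, ← hA.lq_eq_rq hcic]
  exact (hA.leftQuotient hcic).leftQuotient hcic

theorem lq_vOp (hcic : IsCIC H) (hA : IsNonemptyFrac H A) :
    lq (H : Set G) (vOp H A) = lq (H : Set G) A := by
  rw [(hA.closure hcic).lq_eq_rq hcic, rq_vOp, hA.lq_eq_rq hcic]

theorem vOp_mul_vOp (hcic : IsCIC H) (hA : IsNonemptyFrac H A) (hB : IsNonemptyFrac H B) :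
    vOp H (A * vOp H B) = vOp H (A * B) := by
  rw [vOp, ← (hA.mul (hB.closure hcic)).lq_eq_rq hcic, lq_mul, hB.lq_vOp hcic, ← lq_mul,
    (hA.mul hB).lq_eq_rq hcic, ← vOp]

theorem vOp_lq_mul_self (hcic : IsCIC H) (hA : IsNonemptyFrac H A) :
    vOp H (lq (H : Set G) A * A) = H := by
  rw [vOp, ← ((hA.leftQuotient hcic).mul hA).lq_eq_rq hcic, lq_mul, (hA.leftQuotient hcic).lq_self hcic,
    lq_coe_self]

theorem vOp_mul_lq_self (hcic : IsCIC H) (hA : IsNonemptyFrac H A) :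
    vOp H (A * lq (H : Set G) A) = H := by
  rw [vOp, rq_mul, ← hA.lq_eq_rq hcic, (hA.leftQuotient hcic).rq_self hcic, lq_coe_self]

theorem vOp_lq (hcic : IsCIC H) (hA : IsNonemptyFrac H A) :
    vOp H (lq (H : Set G) A) = lq (H : Set G) A := by
  rw [vOp, ← (hA.leftQuotient hcic).lq_eq_rq hcic, hA.lq_eq_rq hcic, ← vOp, hA.lq_vOp hcic,
    hA.lq_eq_rq hcic]

theorem inter (hq : IsQG H) (hA : IsNonemptyFrac H A) (hB : IsNonemptyFrac H B) :
    IsNonemptyFrac H (A ∩ B) where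
  mul_mem_left h hh x hx := ⟨hA.mul_mem_left h hh x hx.1, hB.mul_mem_left h hh x hx.2⟩
  mul_mem_right h hh x hx := ⟨hA.mul_mem_right h hh x hx.1, hB.mul_mem_right h hh x hx.2⟩
  nonempty := by
    obtain ⟨a, ha⟩ := hA.nonempty
    obtain ⟨b, hb⟩ := hB.nonempty
    obtain ⟨u, hu, v, hv, huv⟩ := hq.1 (b * a⁻¹)
    refine ⟨u * b, ?_, hB.mul_mem_left u hu b hb⟩
    rw [show u * b = v * a by rw [← mul_inv_eq_iff_eq_mul, mul_assoc, huv, mul_inv_cancel_left]]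
    exact hA.mul_mem_left v hv a ha
  lq_nonempty := hA.lq_nonempty.mono (lq_anti_right _ Set.inter_subset_left)
  rq_nonempty := hA.rq_nonempty.mono (rq_anti_right _ Set.inter_subset_left)

theorem union (hq : IsQG H) (hA : IsNonemptyFrac H A) (hB : IsNonemptyFrac H B) :
    IsNonemptyFrac H (A ∪ B) where
  mul_mem_left h hh _ hx := hx.imp (hA.mul_mem_left h hh _) (hB.mul_mem_left h hh _)
  mul_mem_right h hh _ hx := hx.imp (hA.mul_mem_right h hh _) (hB.mul_mem_right h hh _)
  nonempty := hA.nonempty.inl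
  lq_nonempty := by
    obtain ⟨a, ha⟩ := hA.lq_nonempty
    obtain ⟨b, hb⟩ := hB.lq_nonempty
    obtain ⟨u, hu, v, hv, huv⟩ := hq.1 (b * a⁻¹)
    refine ⟨u * b, ?_⟩
    rintro x (hx | hx)
    · rw [show u * b = v * a by rw [← mul_inv_eq_iff_eq_mul, mul_assoc, huv, mul_inv_cancel_left], mul_assoc]
      exact H.mul_mem hv (ha x hx)
    · rw [mul_assoc]
      exact H.mul_mem hu (hb x hx)
  rq_nonempty := by
    obtain ⟨a, ha⟩ := hA.rq_nonempty
    obtain ⟨b, hb⟩ := hB.rq_nonempty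
    obtain ⟨u, hu, v, hv, huv⟩ := hq.2 (a⁻¹ * b)
    refine ⟨a * u, ?_⟩
    rintro x (hx | hx)
    · rw [← mul_assoc]
      exact H.mul_mem (ha x hx) hu
    · rw [show a * u = b * v by rw [← mul_inv_eq_iff_eq_mul, mul_assoc, ← huv]; group, ← mul_assoc]
      exact H.mul_mem (hb x hx) hv

end IsNonemptyFrac

variable (H) in
/-- The non-empty divisorial fractional ideals of `H`, ordered by inclusion. -/
def DivFrac : Type _ := {A : Set G // IsNonemptyFrac H A ∧ vOp H A = A}

namespace DivFrac

instance : PartialOrder (DivFrac H) := inferInstanceAs (PartialOrder (Subtype _))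

/-- The `v`-closure of a non-empty fractional ideal. -/
def closure (hcic : IsCIC H) (A : Set G) (hA : IsNonemptyFrac H A) : DivFrac H :=
  ⟨vOp H A, hA.closure hcic, vOp_vOp H A⟩

/-- The group of divisorial fractional ideals under `v`-multiplication. -/
abbrev group (hcic : IsCIC H) : Group (DivFrac H) :=
  letI : Mul (DivFrac H) := ⟨fun A B => closure hcic (A.1 * B.1) (A.2.1.mul B.2.1)⟩
  letI : Inv (DivFrac H) := ⟨fun A => ⟨lq (H : Set G) A.1, A.2.1.leftQuotient hcic, A.2.1.vOp_lq hcic⟩⟩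
  letI : One (DivFrac H) := ⟨⟨H, IsNonemptyFrac.coe H, vOp_coe H⟩⟩
  Group.ofLeftAxioms
    (fun A B C => Subtype.ext <| by
      change vOp H (vOp H (A.1 * B.1) * C.1) = vOp H (A.1 * vOp H (B.1 * C.1))
      rw [vOp_vOp_mul, A.2.1.vOp_mul_vOp hcic (B.2.1.mul C.2.1), mul_assoc])
    (fun A => Subtype.ext <| by
      change vOp H ((H : Set G) * A.1) = A.1
      rw [A.2.1.coe_mul, A.2.2])
    (fun A => Subtype.ext (A.2.1.vOp_lq_mul_self hcic))

/-- The lattice of divisorial fractional ideals. -/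
abbrev lattice (hq : IsQG H) (hcic : IsCIC H) : Lattice (DivFrac H) where
  __ := (inferInstance : PartialOrder (DivFrac H))
  sup A B := closure hcic (A.1 ∪ B.1) (A.2.1.union hq B.2.1)
  inf A B := ⟨A.1 ∩ B.1, A.2.1.inter hq B.2.1, Set.Subset.antisymm
    (Set.subset_inter ((vOp_mono Set.inter_subset_left).trans A.2.2.subset)
      ((vOp_mono Set.inter_subset_right).trans B.2.2.subset)) (subset_vOp H _)⟩
  le_sup_left A B := Set.subset_union_left.trans (subset_vOp H (A.1 ∪ B.1))
  le_sup_right A B := Set.subset_union_right.trans (subset_vOp H (A.1 ∪ B.1))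
  sup_le _ _ C hA hB := (vOp_mono (Set.union_subset hA hB)).trans C.2.2.subset
  inf_le_left A B := Set.inter_subset_left (s := A.1) (t := B.1)
  inf_le_right A B := Set.inter_subset_right (s := A.1) (t := B.1)
  le_inf _ B C hB hC := Set.subset_inter (s := B.1) (t := C.1) hB hC

theorem hasBoundedSups (hq : IsQG H) (hcic : IsCIC H) :
    @HasBoundedSups (DivFrac H) (lattice hq hcic) := by
  rintro s ⟨A, hA⟩ ⟨C, hC⟩
  let U : Set G := {x | ∃ B ∈ s, x ∈ B.1}
  have hsub {D : DivFrac H} (hD : ∀ B ∈ s, B.1 ⊆ D.1) : U ⊆ D.1 := fun x ⟨B, hB, hx⟩ => hD B hB hx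
  have hC : ∀ B ∈ s, B.1 ⊆ C.1 := fun B hB => hC hB
  have hle {B : DivFrac H} (hB : B ∈ s) : B.1 ⊆ U := fun x hx => ⟨B, hB, hx⟩
  have hU : IsNonemptyFrac H U :=
    { mul_mem_left := fun h hh x ⟨B, hB, hx⟩ => ⟨B, hB, B.2.1.mul_mem_left h hh x hx⟩
      mul_mem_right := fun h hh x ⟨B, hB, hx⟩ => ⟨B, hB, B.2.1.mul_mem_right h hh x hx⟩
      nonempty := A.2.1.nonempty.mono (hle hA)
      lq_nonempty := C.2.1.lq_nonempty.mono (lq_anti_right _ (hsub hC))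
      rq_nonempty := C.2.1.rq_nonempty.mono (rq_anti_right _ (hsub hC)) }
  refine ⟨closure hcic U hU, fun B hB => ?_, fun D hD => ?_⟩
  · exact (hle hB).trans (subset_vOp H U)
  · exact (vOp_mono (hsub fun B hB => hD hB)).trans D.2.2.subset

end DivFrac

/-- In a completely integrally closed monoid, `v`-multiplication of non-empty divisorial ideals
is commutative. -/
theorem vOp_mul_comm (hq : IsQG H) (hcic : IsCIC H) (hA : IsNonemptyFrac H A)
    (hB : IsNonemptyFrac H B) (hAv : vOp H A = A) (hBv : vOp H B = B) (hAH : A ⊆ H) (hBH : B ⊆ H) :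
    vOp H (A * B) = vOp H (B * A) := by
  let := DivFrac.group hcic
  let := DivFrac.lattice hq hcic
  have : MulLeftMono (DivFrac H) :=
    ⟨fun C _ _ h => vOp_mono (Set.mul_subset_mul_left (s := C.1) h)⟩
  have : MulRightMono (DivFrac H) :=
    ⟨fun C _ _ h => vOp_mono (Set.mul_subset_mul_right (t := C.1) h)⟩
  let a : DivFrac H := ⟨A, hA, hAv⟩
  let b : DivFrac H := ⟨B, hB, hBv⟩
  have ha : a ≤ 1 := hAH
  have hb : b ≤ 1 := hBH
  have key : b⁻¹ * a⁻¹ = a⁻¹ * b⁻¹ := mul_comm_of_one_le (DivFrac.hasBoundedSups hq hcic)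
    (one_le_inv'.2 hb) (one_le_inv'.2 ha)
  rw [← mul_inv_rev, ← mul_inv_rev, inv_inj] at key
  exact congrArg Subtype.val key

theorem IsVInv.nonempty (hA : IsVInv H A) : A.Nonempty := by
  by_contra! hne
  have h1 : (1 : G) ∈ vOp H (A * lq (H : Set G) A) := by rw [hA.2.1]; exact H.one_mem
  rw [hne, Set.empty_mul, ← hne, ← hA.1.2, hne] at h1
  exact h1

theorem IsNonemptyFrac.isVInv (hcic : IsCIC H) (hA : IsNonemptyFrac H A) (hAH : A ⊆ H)
    (hAv : vOp H A = A) : IsVInv H A :=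
  ⟨⟨hA.isIdeal hAH, hAv.symm⟩, hA.vOp_mul_lq_self hcic, hA.vOp_lq_mul_self hcic⟩

end VIdeals

/-- In a completely integrally closed monoid, the set `I_v^*(H)` of v-invertible
divisorial ideals contains `H` as a unit element, is closed under
v-multiplication, and v-multiplication is commutative on it. -/
theorem stmt5 {G : Type*} [Group G] (H : Submonoid G) (hq : IsQG H) (hcic : IsCIC H) :
    IsVInv H (H : Set G) ∧
    (∀ a : Set G, IsVInv H a →
      vOp H ((H : Set G) * a) = a ∧ vOp H (a * (H : Set G)) = a) ∧
    (∀ a b : Set G, IsVInv H a → IsVInv H b →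
      vOp H (a * b) = vOp H (b * a) ∧ IsVInv H (vOp H (a * b))) := by
  refine ⟨(IsNonemptyFrac.coe H).isVInv hcic subset_rfl (vOp_coe H), fun a ha => ?_,
    fun a b ha hb => ?_⟩
  · rw [ha.1.1.2.1, ha.1.1.2.2]
    exact ⟨ha.1.2.symm, ha.1.2.symm⟩
  · have hA := IsNonemptyFrac.of_isIdeal ha.1.1 ha.nonempty
    have hB := IsNonemptyFrac.of_isIdeal hb.1.1 hb.nonempty
    refine ⟨vOp_mul_comm hq hcic hA hB ha.1.2.symm hb.1.2.symm ha.1.1.1 hb.1.1.1,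
      ((hA.mul hB).closure hcic).isVInv hcic ?_ (vOp_vOp H _)⟩
    refine (vOp_mono ?_).trans (vOp_coe H).subset
    rintro _ ⟨x, hx, y, hy, rfl⟩
    exact H.mul_mem (ha.1.1.1 hx) (hb.1.1.1 hy)
end

section
/- Let H be a monoid with quotient group G. Then the following are equivalent: (a) H is normalizing, i.e. aH = Ha for all a ∈ H; (b) (H :ₗ X) = (H :ᵣ X) for all subsets X ⊆ G; (c) HX = XH for all subsets X ⊆ G; (d) every fractional left ideal of H is a fractional ideal; (f) for every a ∈ G, the set Ha is a fractional ideal of H. -/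
open scoped Pointwise

/-- `{a} * H = H * {a}` for all `a ∈ H` forces `H` to be stable under conjugation by its
quotient group. -/
theorem conj_mem_of_normalizing {G : Type*} [Group G] {H : Submonoid G} (hq : IsQG H)
    (hn : ∀ a ∈ H, ({a} : Set G) * (H : Set G) = (H : Set G) * {a}) (g : G) {h : G}
    (hh : h ∈ H) : g * h * g⁻¹ ∈ H := by
  obtain ⟨a, ha, b, hb, rfl⟩ := hq.1 g
  have hbh : b * h ∈ (H : Set G) * {b} := hn b hb ▸ Set.mul_mem_mul rfl hh
  rw [Set.mul_singleton] at hbh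
  obtain ⟨k, hk, hkb⟩ := hbh
  have hka : k * a ∈ ({a} : Set G) * (H : Set G) := (hn a ha).symm ▸ Set.mul_mem_mul hk rfl
  rw [Set.singleton_mul] at hka
  obtain ⟨l, hl, hla⟩ := hka
  dsimp only at hkb hla
  have heq : a⁻¹ * b * h * (a⁻¹ * b)⁻¹ = l :=
    calc a⁻¹ * b * h * (a⁻¹ * b)⁻¹ = a⁻¹ * (b * h) * (b⁻¹ * a) := by group
      _ = a⁻¹ * (k * a) := by rw [← hkb]; group
      _ = l := by rw [← hla, inv_mul_cancel_left]
  exact heq ▸ hl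

/-- A conjugation-stable submonoid is closed under cyclic permutation of products. -/
theorem mul_mem_swap_of_conj_mem {G : Type*} [Group G] {H : Submonoid G}
    (hc : ∀ g : G, ∀ h ∈ H, g * h * g⁻¹ ∈ H) {x y : G} (hxy : x * y ∈ H) : y * x ∈ H := by
  simpa [mul_assoc] using hc x⁻¹ _ hxy

/-- A conjugation-stable submonoid commutes with every subset of the group. -/
theorem mul_set_comm_of_conj_mem {G : Type*} [Group G] {H : Submonoid G}
    (hc : ∀ g : G, ∀ h ∈ H, g * h * g⁻¹ ∈ H) (X : Set G) :
    (H : Set G) * X = X * (H : Set G) := by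
  ext y
  constructor
  · rintro ⟨h, hh, x, hx, rfl⟩
    exact ⟨x, hx, x⁻¹ * h * x, by simpa using hc x⁻¹ h hh, by group⟩
  · rintro ⟨x, hx, h, hh, rfl⟩
    exact ⟨x * h * x⁻¹, hc x h hh, x, hx, by group⟩

/-- Characterizations of normalizing monoids: (a) `aH = Ha` for all `a ∈ H`;
(b) `(H :ₗ X) = (H :ᵣ X)` for all `X ⊆ q(H)`; (c) `HX = XH` for all
`X ⊆ q(H)`; (d) every fractional left ideal is a fractional ideal; (f) `Ha` is
a fractional ideal for every `a ∈ q(H)`. -/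
theorem stmt11 {G : Type*} [Group G] (H : Submonoid G) (hq : IsQG H) :
    [∀ a ∈ H, ({a} : Set G) * (H : Set G) = (H : Set G) * {a},
     ∀ X : Set G, lq (H : Set G) X = rq (H : Set G) X,
     ∀ X : Set G, (H : Set G) * X = X * (H : Set G),
     ∀ a : Set G, ((H : Set G) * a = a ∧ ∃ d ∈ H, ∀ x ∈ a, x * d ∈ H) →
       IsFracIdeal H a,
     ∀ g : G, IsFracIdeal H ((H : Set G) * ({g} : Set G))].TFAE := by
  tfae_have 1 → 2 := by
    intro hn X
    have hc (g : G) (h : G) (hh : h ∈ H) := conj_mem_of_normalizing hq hn g hh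
    ext x
    exact ⟨fun hx b hb => mul_mem_swap_of_conj_mem hc (hx b hb),
      fun hx b hb => mul_mem_swap_of_conj_mem hc (hx b hb)⟩
  tfae_have 2 → 3 := by
    intro hquot
    refine mul_set_comm_of_conj_mem fun g h hh => ?_
    have hmem : g⁻¹ ∈ lq (H : Set G) {g * h} := by
      rintro _ rfl
      simpa using hh
    rw [hquot] at hmem
    exact hmem _ rfl
  tfae_have 3 → 1 := fun hcomm a _ => (hcomm {a}).symm
  tfae_have 1 → 4 := by
    rintro hn a ⟨hHa, d, hd, had⟩
    have hc (g : G) (h : G) (hh : h ∈ H) := conj_mem_of_normalizing hq hn g hh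
    exact ⟨hHa, (mul_set_comm_of_conj_mem hc a).symm.trans hHa,
      ⟨d, hd, fun x hx => mul_mem_swap_of_conj_mem hc (had x hx)⟩, d, hd, had⟩
  tfae_have 4 → 5 := by
    intro hfrac g
    obtain ⟨c, hc, d, hd, rfl⟩ := hq.2 g
    refine hfrac _ ⟨by rw [← mul_assoc, coe_mul_coe], d, hd, ?_⟩
    rintro _ ⟨h, hh, _, rfl, rfl⟩
    simpa [mul_assoc] using H.mul_mem hh hc
  tfae_have 5 → 3 := by
    intro hfrac
    refine mul_set_comm_of_conj_mem fun g h hh => ?_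
    have hmem : g * h ∈ (H : Set G) * {g} := by
      rw [← (hfrac g).2.1]
      exact Set.mul_mem_mul ⟨1, H.one_mem, g, rfl, one_mul g⟩ hh
    obtain ⟨k, hk, _, rfl, hkg⟩ := hmem
    rw [← hkg]
    simpa using hk
  tfae_finish
end

section
/- Let D be a monoid and H ⊆ D a saturated submonoid. If D satisfies the ascending chain condition on divisorial left ideals of D, then H is v-noetherian, i.e. H satisfies the ascending chain condition on divisorial ideals of H. -/
open scoped Pointwise

/-- Left quotient formed inside a subset `Q` (the quotient group of a
submonoid): `{x ∈ Q | x B ⊆ A}`. -/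
def lqIn {G : Type*} [Group G] (Q A B : Set G) : Set G := {x ∈ Q | ∀ b ∈ B, x * b ∈ A}

/-- Right quotient formed inside a subset `Q`: `{x ∈ Q | B x ⊆ A}`. -/
def rqIn {G : Type*} [Group G] (Q A B : Set G) : Set G := {x ∈ Q | ∀ b ∈ B, b * x ∈ A}

section Quotients

variable {G : Type*} [Group G]

theorem lq_anti (A : Set G) {B C : Set G} (h : B ⊆ C) : lq A C ⊆ lq A B :=
  fun _ hx b hb => hx b (h hb)

theorem rq_anti (A : Set G) {B C : Set G} (h : B ⊆ C) : rq A C ⊆ rq A B :=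
  fun _ hx b hb => hx b (h hb)

theorem subset_lq_rq (A B : Set G) : B ⊆ lq A (rq A B) :=
  fun b hb _ hx => hx b hb

theorem subset_rq_lq (A B : Set G) : B ⊆ rq A (lq A B) :=
  fun b hb _ hx => hx b hb

theorem lq_rq_lq (A B : Set G) : lq A (rq A (lq A B)) = lq A B :=
  (lq_anti A (subset_rq_lq A B)).antisymm (subset_lq_rq A _)

theorem lq_subset_of_one_mem (A : Set G) {B : Set G} (h : (1 : G) ∈ B) : lq A B ⊆ A :=
  fun x hx => by simpa using hx 1 h

theorem one_mem_rq_of_subset {A B : Set G} (h : B ⊆ A) : (1 : G) ∈ rq A B :=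
  fun b hb => by simpa using h hb

theorem submonoid_mul_lq (D : Submonoid G) (B : Set G) :
    (D : Set G) * lq (D : Set G) B = lq (D : Set G) B := by
  apply Set.Subset.antisymm
  · rintro _ ⟨d, hd, x, hx, rfl⟩ b hb
    simpa only [mul_assoc, SetLike.mem_coe] using D.mul_mem hd (hx b hb)
  · exact fun x hx => ⟨1, D.one_mem, x, hx, one_mul x⟩

/-- If `D ∩ Q ⊆ H ⊆ D`, then the divisorial closure over `D` of a set, intersected with `Q`,
lies in its divisorial closure over `H`. -/
theorem lq_rq_inter_subset {D H : Submonoid G} {Q : Subgroup G} (hHD : H ≤ D)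
    (hDQ : ∀ g ∈ Q, g ∈ D → g ∈ H) (B : Set G) :
    lq (D : Set G) (rq (D : Set G) B) ∩ Q ⊆
      lqIn (Q : Set G) (H : Set G) (rqIn (Q : Set G) (H : Set G) B) :=
  fun _ hx => ⟨hx.2, fun y hy =>
    hDQ _ (Q.mul_mem hx.2 hy.1) (hx.1 y fun b hb => hHD (hy.2 b hb))⟩

end Quotients

/-- If `H ⊆ D` is a saturated submonoid and `D` satisfies the ascending chain
condition on divisorial left ideals, then `H` is v-noetherian (divisorial
ideals of `H` are formed in the quotient group `q(H)` of `H`). -/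
theorem stmt13 {G : Type*} [Group G] (D : Submonoid G) (hqD : IsQG D)
    (H : Submonoid G) (hHD : H ≤ D)
    (hsat : ∀ a ∈ H, ∀ b ∈ H,
      (b ∈ ({a} : Set G) * (D : Set G) → b ∈ ({a} : Set G) * (H : Set G)) ∧
      (b ∈ (D : Set G) * ({a} : Set G) → b ∈ (H : Set G) * ({a} : Set G)))
    -- `Q` is the quotient group of `H`
    (Q : Subgroup G) (hHQ : (H : Set G) ⊆ Q)
    (hQ : ∀ g ∈ Q, (∃ a ∈ H, ∃ b ∈ H, g = a⁻¹ * b) ∧ (∃ c ∈ H, ∃ d ∈ H, g = c * d⁻¹))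
    -- ACC on divisorial left ideals of `D`
    (hacc : ∀ f : ℕ → Set G,
      (∀ n, f n ⊆ (D : Set G) ∧ (D : Set G) * f n = f n ∧
        f n = lq (D : Set G) (rq (D : Set G) (f n))) →
      (∀ n, f n ⊆ f (n + 1)) → ∃ N, ∀ n, N ≤ n → f n = f N) :
    -- ACC on divisorial ideals of `H`
    ∀ f : ℕ → Set G,
      (∀ n, IsIdeal H (f n) ∧
        f n = lqIn (Q : Set G) (H : Set G) (rqIn (Q : Set G) (H : Set G) (f n)) ∧
        f n = rqIn (Q : Set G) (H : Set G) (lqIn (Q : Set G) (H : Set G) (f n))) →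
      (∀ n, f n ⊆ f (n + 1)) → ∃ N, ∀ n, N ≤ n → f n = f N := by
  intro f hf hmono
  have hDQ : ∀ g ∈ Q, g ∈ D → g ∈ H := by
    intro g hg hgD
    obtain ⟨a, ha, b, hb, rfl⟩ := (hQ g hg).1
    obtain ⟨_, rfl, h, hh, hab⟩ :=
      (hsat a ha b hb).1 ⟨a, rfl, a⁻¹ * b, hgD, mul_inv_cancel_left a b⟩
    rw [← hab]
    simpa using hh
  have hfD : ∀ n, f n ⊆ (D : Set G) := fun n x hx => hHD ((hf n).1.1 hx)
  obtain ⟨N, hN⟩ := hacc (fun n => lq (D : Set G) (rq (D : Set G) (f n)))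
    (fun n => ⟨lq_subset_of_one_mem _ (one_mem_rq_of_subset (hfD n)),
      submonoid_mul_lq D _, (lq_rq_lq _ _).symm⟩)
    (fun n => lq_anti _ (rq_anti _ (hmono n)))
  refine ⟨N, fun n hn => Set.Subset.antisymm (fun x hx => ?_) (monotone_nat_of_le_succ hmono hn)⟩
  rw [(hf N).2.1]
  refine lq_rq_inter_subset hHD hDQ (f N) ⟨?_, hHQ ((hf n).1.1 hx)⟩
  have hx' := subset_lq_rq (D : Set G) (f n) hx
  exact hN n hn ▸ hx'
end

section
/- Let H and D be monoids and φ : H → D a divisor homomorphism with φ(H) contained in the normalizing submonoid N(D) = {d ∈ D | dD = Dd}. Then: (a) if D is completely integrally closed, then H is completely integrally closed; (b) H is normalizing, i.e. aH = Ha for all a ∈ H. -/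
open scoped Pointwise

/-- If every element of `S` normalizes `D`, then `S D = D S`. -/
theorem mul_eq_mul_swap_of_normalizing {G : Type*} [Group G] {D : Submonoid G} {S : Set G}
    (hn : ∀ s ∈ S, ({s} : Set G) * (D : Set G) = (D : Set G) * {s}) :
    S * (D : Set G) = (D : Set G) * S := by
  ext z
  constructor
  · rintro ⟨s, hs, d, hd, rfl⟩
    obtain ⟨d', hd', s', rfl, h⟩ := (hn s hs).subset (Set.mul_mem_mul rfl hd)
    exact ⟨d', hd', s', hs, h⟩
  · rintro ⟨d, hd, s, hs, rfl⟩
    obtain ⟨s', rfl, d', hd', h⟩ := (hn s hs).superset (Set.mul_mem_mul hd rfl)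
    exact ⟨s', hs, d', hd', h⟩

/-- If every element of `S ⊆ D` normalizes `D`, then `S D` is an ideal of `D`. -/
theorem isIdeal_mul_of_normalizing {G : Type*} [Group G] {D : Submonoid G} {S : Set G}
    (hS : S ⊆ D) (hn : ∀ s ∈ S, ({s} : Set G) * (D : Set G) = (D : Set G) * {s}) :
    IsIdeal D (S * (D : Set G)) := by
  refine ⟨?_, ?_, ?_⟩
  · rintro _ ⟨s, hs, d, hd, rfl⟩
    exact D.mul_mem (hS hs) hd
  · rw [mul_eq_mul_swap_of_normalizing hn, ← mul_assoc, Submonoid.coe_mul_self_eq]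
  · rw [mul_assoc, Submonoid.coe_mul_self_eq]

/-- Let `φ : H → D` be a divisor homomorphism of monoids with `φ(H)` contained
in the normalizing submonoid `N(D)`. Then: (a) if `D` is completely integrally
closed, so is `H`; (b) `H` is normalizing. -/
theorem stmt14 {G₁ : Type*} [Group G₁] {G₂ : Type*} [Group G₂]
    (H : Submonoid G₁) (hqH : IsQG H) (D : Submonoid G₂) (hqD : IsQG D)
    (φ : ↥H →* ↥D)
    -- `φ(H) ⊆ N(D)`
    (hnd : ∀ h : ↥H, ({(φ h : G₂)} : Set G₂) * (D : Set G₂) =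
      (D : Set G₂) * {(φ h : G₂)})
    -- `φ` is a divisor homomorphism
    (hdiv : ∀ u v : ↥H,
      ((∃ d : ↥D, φ v = φ u * d) → ∃ h : ↥H, v = u * h) ∧
      ((∃ d : ↥D, φ v = d * φ u) → ∃ h : ↥H, v = h * u)) :
    (IsCIC D → IsCIC H) ∧
    (∀ a ∈ H, ({a} : Set G₁) * (H : Set G₁) = (H : Set G₁) * {a}) := by
  constructor
  · intro hD a ⟨haH, hHa, haHr⟩ ⟨e₀, he₀⟩
    set S : Set G₂ := {z | ∃ e : H, (e : G₁) ∈ a ∧ z = φ e}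
    have hn : ∀ s ∈ S, ({s} : Set G₂) * (D : Set G₂) = (D : Set G₂) * {s} := by
      rintro _ ⟨e, -, rfl⟩
      exact hnd e
    have hSD : S ⊆ D := by
      rintro _ ⟨e, -, rfl⟩
      exact (φ e).2
    obtain ⟨hl, hr⟩ := hD _ (isIdeal_mul_of_normalizing hSD hn)
      ⟨_, Set.mul_mem_mul ⟨⟨e₀, haH he₀⟩, he₀, rfl⟩ D.one_mem⟩
    constructor
    · refine Set.Subset.antisymm (fun x hx => ?_)
        fun x hx b hb => hHa.subset (Set.mul_mem_mul hx hb)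
      obtain ⟨p, hp, q, hq, rfl⟩ := hqH.1 x
      have hy : (φ ⟨p, hp⟩ : G₂)⁻¹ * φ ⟨q, hq⟩ ∈ lq (S * (D : Set G₂)) (S * (D : Set G₂)) := by
        rintro _ ⟨_, ⟨e, he, rfl⟩, d, hd, rfl⟩
        have hxe := hx e he
        refine ⟨_, ⟨⟨_, haH hxe⟩, hxe, rfl⟩, d, hd, ?_⟩
        have key : φ ⟨q, hq⟩ * φ e = φ ⟨p, hp⟩ * φ ⟨_, haH hxe⟩ := by
          rw [← map_mul, ← map_mul]
          congr 1
          ext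
          simp [mul_assoc]
        have key' := congrArg (Subtype.val) key
        simp only [Submonoid.coe_mul] at key'
        simp only [← mul_assoc]
        rw [mul_assoc _ _ (φ e : G₂), key', inv_mul_cancel_left]
      rw [hl] at hy
      obtain ⟨h, hh⟩ := (hdiv ⟨p, hp⟩ ⟨q, hq⟩).1 ⟨⟨_, hy⟩, by ext; simp⟩
      have hq' : q = p * h := congrArg Subtype.val hh
      simp [hq']
    · refine Set.Subset.antisymm (fun x hx => ?_)
        fun x hx b hb => haHr.subset (Set.mul_mem_mul hb hx)
      obtain ⟨p, hp, q, hq, rfl⟩ := hqH.2 x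
      have hy : (φ ⟨p, hp⟩ : G₂) * (φ ⟨q, hq⟩ : G₂)⁻¹ ∈
          rq (S * (D : Set G₂)) (S * (D : Set G₂)) := by
        rw [mul_eq_mul_swap_of_normalizing hn]
        rintro _ ⟨d, hd, _, ⟨e, he, rfl⟩, rfl⟩
        have hxe := hx e he
        refine ⟨d, hd, _, ⟨⟨_, haH hxe⟩, hxe, rfl⟩, ?_⟩
        have key : φ e * φ ⟨p, hp⟩ = φ ⟨_, haH hxe⟩ * φ ⟨q, hq⟩ := by
          rw [← map_mul, ← map_mul]
          congr 1
          ext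
          simp [mul_assoc]
        have key' := congrArg (Subtype.val) key
        simp only [Submonoid.coe_mul] at key'
        simp only [mul_assoc]
        rw [← mul_assoc (φ e : G₂), key', mul_inv_cancel_right]
      rw [hr] at hy
      obtain ⟨h, hh⟩ := (hdiv ⟨q, hq⟩ ⟨p, hp⟩).2 ⟨⟨_, hy⟩, by ext; simp⟩
      have hp' : p = h * q := congrArg Subtype.val hh
      simp [hp']
  · intro a ha
    ext z
    constructor
    · rintro ⟨_, rfl, h, hh, rfl⟩
      obtain ⟨d, hd, _, rfl, hdz⟩ :=
        (hnd ⟨_, ha⟩).subset (Set.mul_mem_mul rfl (φ ⟨h, hh⟩).2)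
      obtain ⟨k, hk⟩ := (hdiv ⟨_, ha⟩ (⟨_, ha⟩ * ⟨h, hh⟩)).2
        ⟨⟨d, hd⟩, by rw [map_mul]; exact Subtype.ext hdz.symm⟩
      exact ⟨k, k.2, _, rfl, (congrArg Subtype.val hk).symm⟩
    · rintro ⟨h, hh, _, rfl, rfl⟩
      obtain ⟨_, rfl, d, hd, hdz⟩ :=
        (hnd ⟨_, ha⟩).superset (Set.mul_mem_mul (φ ⟨h, hh⟩).2 rfl)
      obtain ⟨k, hk⟩ := (hdiv ⟨_, ha⟩ (⟨h, hh⟩ * ⟨_, ha⟩)).1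
        ⟨⟨d, hd⟩, by rw [map_mul]; exact Subtype.ext hdz.symm⟩
      exact ⟨_, rfl, k, k.2, (congrArg Subtype.val hk).symm⟩
end

section
/- Let H be a monoid and 𝔪 = H \ H^× the set of non-units. Then the following are equivalent: (a) H is a BF-monoid, i.e. for every a ∈ H \ H^× the set of lengths L(a) is finite and non-empty; (b) the intersection of all powers 𝔪ⁿ (n ≥ 0) is empty; (c) there exists a length function on H, i.e. a map λ : H → ℕ such that λ(a) < λ(b) whenever b ∈ (aH ∪ Ha) \ (aH^× ∪ H^×a). -/
open scoped Pointwise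

/-- The set of invertible elements `H^×` of `H`. -/
def unitSet {G : Type*} [Group G] (H : Submonoid G) : Set G :=
  {u | u ∈ H ∧ u⁻¹ ∈ H}

/-- `a` is an atom of `H`: a non-unit which is not a product of two non-units. -/
def IsAtomOf {G : Type*} [Group G] (H : Submonoid G) (a : G) : Prop :=
  a ∈ H ∧ a ∉ unitSet H ∧
  ∀ u ∈ H, ∀ v ∈ H, a = u * v → u ∈ unitSet H ∨ v ∈ unitSet H

/-- The set of lengths `L(a)` of factorizations of `a` into atoms of `H`. -/
def lengthsOf {G : Type*} [Group G] (H : Submonoid G) (a : G) : Set ℕ :=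
  {k | ∃ l : List G, l.length = k ∧ (∀ x ∈ l, IsAtomOf H x) ∧ a = l.prod}

section BFMonoid

variable {G : Type*} [Group G] {H : Submonoid G}

/-- The set `𝔪 = H \ H^×` of non-units of `H`. -/
abbrev nonunitSet (H : Submonoid G) : Set G := (H : Set G) \ unitSet H

theorem one_mem_unitSet : (1 : G) ∈ unitSet H := by simp [unitSet]

theorem inv_mem_unitSet {u : G} (hu : u ∈ unitSet H) : u⁻¹ ∈ unitSet H :=
  ⟨hu.2, by simpa using hu.1⟩

theorem mul_mem_unitSet {u v : G} (hu : u ∈ unitSet H) (hv : v ∈ unitSet H) :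
    u * v ∈ unitSet H :=
  ⟨H.mul_mem hu.1 hv.1, by simpa using H.mul_mem hv.2 hu.2⟩

theorem nonunitSet_mul_mem {x y : G} (hx : x ∈ nonunitSet H) (hy : y ∈ H) :
    x * y ∈ nonunitSet H :=
  ⟨H.mul_mem hx.1 hy, fun h => hx.2 ⟨hx.1, by simpa using H.mul_mem hy h.2⟩⟩

theorem mul_nonunitSet_mem {x y : G} (hx : x ∈ H) (hy : y ∈ nonunitSet H) :
    x * y ∈ nonunitSet H :=
  ⟨H.mul_mem hx hy.1, fun h => hy.2 ⟨hy.1, by simpa using H.mul_mem h.2 hx⟩⟩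

theorem nonunitSet_pow_succ_antitone :
    Antitone fun n : ℕ => nonunitSet H ^ (n + 1) := by
  refine antitone_nat_of_succ_le fun n => ?_
  rw [pow_succ, pow_succ, mul_assoc]
  refine Set.mul_subset_mul_left ?_
  rintro _ ⟨x, hx, y, hy, rfl⟩
  exact nonunitSet_mul_mem hx hy.1

theorem nonunitSet_pow_succ_subset (n : ℕ) : nonunitSet H ^ (n + 1) ⊆ nonunitSet H := by
  simpa using nonunitSet_pow_succ_antitone (H := H) (Nat.zero_le n)

/-- The supremum of all `n` with `a ∈ 𝔪ⁿ`. -/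
noncomputable def nonunitOrder (H : Submonoid G) (a : G) : ℕ :=
  sSup {n : ℕ | a ∈ nonunitSet H ^ n}

theorem bddAbove_nonunitSet_pow (hb : (⋂ n : ℕ, nonunitSet H ^ (n + 1)) = ∅) (a : G) :
    BddAbove {n : ℕ | a ∈ nonunitSet H ^ n} := by
  have ha : a ∉ ⋂ n : ℕ, nonunitSet H ^ (n + 1) := by simp [hb]
  simp only [Set.mem_iInter, not_forall] at ha
  obtain ⟨N, hN⟩ := ha
  refine ⟨N, fun n hn => ?_⟩
  by_contra! hlt
  obtain ⟨k, rfl⟩ : ∃ k, n = k + 1 := ⟨n - 1, by omega⟩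
  exact hN (nonunitSet_pow_succ_antitone (by omega : N ≤ k) hn)

theorem le_nonunitOrder (hb : (⋂ n : ℕ, nonunitSet H ^ (n + 1)) = ∅) {a : G} {n : ℕ}
    (ha : a ∈ nonunitSet H ^ n) : n ≤ nonunitOrder H a :=
  le_csSup (bddAbove_nonunitSet_pow hb a) ha

theorem mem_nonunitSet_pow_nonunitOrder (hb : (⋂ n : ℕ, nonunitSet H ^ (n + 1)) = ∅) {a : G}
    (ha : a ∈ nonunitSet H) : a ∈ nonunitSet H ^ nonunitOrder H a :=
  Nat.sSup_mem ⟨1, by simpa using ha⟩ (bddAbove_nonunitSet_pow hb a)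

theorem nonunitOrder_eq_zero {a : G} (ha : a ∈ unitSet H) : nonunitOrder H a = 0 := by
  refine Nat.le_zero.mp (csSup_le' ?_)
  rintro (_ | n) hn
  · exact le_rfl
  · exact absurd ha (nonunitSet_pow_succ_subset n hn).2

theorem nonunitOrder_lt_mul_right (hb : (⋂ n : ℕ, nonunitSet H ^ (n + 1)) = ∅) {a h : G}
    (ha : a ∈ H) (hh : h ∈ nonunitSet H) : nonunitOrder H a < nonunitOrder H (a * h) := by
  by_cases hu : a ∈ unitSet H
  · rw [nonunitOrder_eq_zero hu]
    exact le_nonunitOrder hb (by simpa only [pow_one] using mul_nonunitSet_mem ha hh)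
  · refine le_nonunitOrder hb ?_
    rw [Nat.succ_eq_add_one, pow_succ]
    exact Set.mul_mem_mul (mem_nonunitSet_pow_nonunitOrder hb ⟨ha, hu⟩) hh

theorem nonunitOrder_lt_mul_left (hb : (⋂ n : ℕ, nonunitSet H ^ (n + 1)) = ∅) {a h : G}
    (ha : a ∈ H) (hh : h ∈ nonunitSet H) : nonunitOrder H a < nonunitOrder H (h * a) := by
  by_cases hu : a ∈ unitSet H
  · rw [nonunitOrder_eq_zero hu]
    exact le_nonunitOrder hb (by simpa only [pow_one] using nonunitSet_mul_mem hh ha)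
  · refine le_nonunitOrder hb ?_
    rw [Nat.succ_eq_add_one, pow_succ']
    exact Set.mul_mem_mul hh (mem_nonunitSet_pow_nonunitOrder hb ⟨ha, hu⟩)

theorem mem_nonunitSet_pow_of_mem_lengthsOf {a : G} {k : ℕ} (hk : k ∈ lengthsOf H a) :
    a ∈ nonunitSet H ^ k := by
  obtain ⟨l, rfl, hl, rfl⟩ := hk
  induction l with
  | nil => simp
  | cons x l ih =>
    rw [List.forall_mem_cons] at hl
    rw [List.length_cons, pow_succ', List.prod_cons]
    exact Set.mul_mem_mul ⟨hl.1.1, hl.1.2.1⟩ (ih hl.2)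

theorem add_mem_lengthsOf_mul {a b : G} {k m : ℕ} (hk : k ∈ lengthsOf H a)
    (hm : m ∈ lengthsOf H b) : k + m ∈ lengthsOf H (a * b) := by
  obtain ⟨l, rfl, hl, rfl⟩ := hk
  obtain ⟨l', rfl, hl', rfl⟩ := hm
  refine ⟨l ++ l', by simp, fun x hx => ?_, by simp⟩
  exact (List.mem_append.mp hx).elim (hl x) (hl' x)

theorem lengthsOf_nonempty (hb : (⋂ n : ℕ, nonunitSet H ^ (n + 1)) = ∅) {a : G}
    (ha : a ∈ nonunitSet H) : (lengthsOf H a).Nonempty := by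
  induction hn : nonunitOrder H a using Nat.strong_induction_on generalizing a with
  | _ n ih =>
    by_cases hat : IsAtomOf H a
    · exact ⟨1, [a], rfl, by simpa using hat, by simp⟩
    · obtain ⟨u, hu, v, hv, rfl, hu', hv'⟩ :
          ∃ u ∈ H, ∃ v ∈ H, a = u * v ∧ u ∉ unitSet H ∧ v ∉ unitSet H := by
        by_contra! hcon
        refine hat ⟨ha.1, ha.2, fun u hu v hv huv => ?_⟩
        exact or_iff_not_imp_left.mpr (hcon u hu v hv huv)
      obtain ⟨k, hk⟩ :=
        ih _ (hn ▸ nonunitOrder_lt_mul_right hb hu ⟨hv, hv'⟩) ⟨hu, hu'⟩ rfl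
      obtain ⟨m, hm⟩ :=
        ih _ (hn ▸ nonunitOrder_lt_mul_left hb hv ⟨hu, hu'⟩) ⟨hv, hv'⟩ rfl
      exact ⟨k + m, add_mem_lengthsOf_mul hk hm⟩

theorem lengthsOf_finite (hb : (⋂ n : ℕ, nonunitSet H ^ (n + 1)) = ∅) (a : G) :
    (lengthsOf H a).Finite :=
  (bddAbove_nonunitSet_pow hb a).finite.subset fun _ => mem_nonunitSet_pow_of_mem_lengthsOf

theorem exists_le_mem_lengthsOf (hne : ∀ a ∈ nonunitSet H, (lengthsOf H a).Nonempty) (n : ℕ)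
    {a : G} (ha : a ∈ nonunitSet H ^ n) : ∃ k ∈ lengthsOf H a, n ≤ k := by
  induction n generalizing a with
  | zero =>
    rw [pow_zero, Set.mem_one] at ha
    exact ⟨0, ⟨[], rfl, by simp, by simpa using ha⟩, le_rfl⟩
  | succ n ih =>
    rw [pow_succ] at ha
    obtain ⟨x, hx, y, hy, rfl⟩ := ha
    obtain ⟨k, hk, hnk⟩ := ih hx
    obtain ⟨m, hm⟩ := hne y hy
    have hm0 : m ≠ 0 := by
      rintro rfl
      have hy1 := mem_nonunitSet_pow_of_mem_lengthsOf hm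
      rw [pow_zero, Set.mem_one] at hy1
      exact hy.2 (hy1 ▸ one_mem_unitSet)
    exact ⟨k + m, add_mem_lengthsOf_mul hk hm, by omega⟩

/-- `lam` is a length function on `H`. -/
def IsLengthFunction (H : Submonoid G) (lam : G → ℕ) : Prop :=
  ∀ a ∈ H, ∀ b ∈ (({a} : Set G) * (H : Set G) ∪ (H : Set G) * {a}) \
    (({a} : Set G) * unitSet H ∪ unitSet H * {a}), lam a < lam b

theorem isLengthFunction_iff {lam : G → ℕ} : IsLengthFunction H lam ↔
    ∀ a ∈ H, ∀ b, (a⁻¹ * b ∈ H ∨ b * a⁻¹ ∈ H) → a⁻¹ * b ∉ unitSet H → b * a⁻¹ ∉ unitSet H →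
      lam a < lam b := by
  simp only [IsLengthFunction, Set.mem_sdiff, Set.mem_union, Set.singleton_mul, Set.mul_singleton,
    Set.image_mul_left, Set.image_mul_right, Set.mem_preimage, SetLike.mem_coe, not_or, and_imp]

theorem isLengthFunction_nonunitOrder (hb : (⋂ n : ℕ, nonunitSet H ^ (n + 1)) = ∅) :
    IsLengthFunction H (nonunitOrder H) := by
  rw [isLengthFunction_iff]
  rintro a ha b (h | h) hr hl
  · simpa using nonunitOrder_lt_mul_right hb ha ⟨h, hr⟩
  · simpa using nonunitOrder_lt_mul_left hb ha ⟨h, hl⟩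

theorem IsLengthFunction.le_pow {lam : G → ℕ} (hlam : IsLengthFunction H lam) {h : G}
    (hh : h ∈ nonunitSet H) (n : ℕ) : n ≤ lam (h ^ n) := by
  rw [isLengthFunction_iff] at hlam
  induction n with
  | zero => exact Nat.zero_le _
  | succ n ih =>
    have hr : (h ^ n)⁻¹ * h ^ (n + 1) = h := by rw [pow_succ]; group
    have hl : h ^ (n + 1) * (h ^ n)⁻¹ = h := by rw [pow_succ']; group
    have := hlam (h ^ n) (H.pow_mem hh.1 n) (h ^ (n + 1)) (by rw [hr]; exact Or.inl hh.1)
      (by rw [hr]; exact hh.2) (by rw [hl]; exact hh.2)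
    omega

/-- In the presence of a length function, `a h ∈ H^× a` forces `h` to be a unit: otherwise `a` would
be a left multiple of every power of `h`. -/
theorem IsLengthFunction.conj_notMem_unitSet {lam : G → ℕ} (hlam : IsLengthFunction H lam)
    {a h : G} (ha : a ∈ H) (hh : h ∈ nonunitSet H) : a * h * a⁻¹ ∉ unitSet H := by
  intro hu
  have key : ∀ n, lam a < n → (h ^ n)⁻¹ * a ∈ unitSet H := by
    intro n hn
    by_contra hr
    refine absurd (isLengthFunction_iff.mp hlam (h ^ n) (H.pow_mem hh.1 n) a (Or.inr ?_) hr ?_)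
      (by have := hlam.le_pow hh n; omega)
    · have hconj : a * (h ^ n)⁻¹ = ((a * h * a⁻¹)⁻¹) ^ n * a := by
        rw [inv_pow, conj_pow]; group
      rw [hconj]
      exact H.mul_mem (H.pow_mem hu.2 n) ha
    · intro hl
      have hconj : h = (a * (h ^ n)⁻¹)⁻¹ * (a * h * a⁻¹) * (a * (h ^ n)⁻¹) := by group
      exact hh.2 (hconj ▸ mul_mem_unitSet (mul_mem_unitSet (inv_mem_unitSet hl) hu) hl)
  have hquot : h = ((h ^ (lam a + 1))⁻¹ * a) * ((h ^ (lam a + 2))⁻¹ * a)⁻¹ := by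
    rw [pow_succ h (lam a + 1)]; group
  exact hh.2 (hquot ▸ mul_mem_unitSet (key _ (by omega)) (inv_mem_unitSet (key _ (by omega))))

theorem IsLengthFunction.lt_mul_right {lam : G → ℕ} (hlam : IsLengthFunction H lam)
    {a h : G} (ha : a ∈ H) (hh : h ∈ nonunitSet H) : lam a < lam (a * h) :=
  isLengthFunction_iff.mp hlam a ha (a * h) (Or.inl (by simpa using hh.1)) (by simpa using hh.2)
    (hlam.conj_notMem_unitSet ha hh)

theorem IsLengthFunction.le_of_mem_pow {lam : G → ℕ} (hlam : IsLengthFunction H lam) (n : ℕ)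
    {a : G} (ha : a ∈ nonunitSet H ^ (n + 1)) : n ≤ lam a := by
  induction n generalizing a with
  | zero => exact Nat.zero_le _
  | succ n ih =>
    rw [pow_succ] at ha
    obtain ⟨x, hx, y, hy, rfl⟩ := ha
    exact (ih hx).trans_lt (hlam.lt_mul_right (nonunitSet_pow_succ_subset n hx).1 hy)

end BFMonoid

/-- Characterization of BF-monoids: with `𝔪 = H \ H^×`, the following are
equivalent: (a) `H` is a BF-monoid; (b) `⋂_{n ≥ 1} 𝔪ⁿ = ∅`; (c) `H` admits a
length function. -/
theorem stmt17 {G : Type*} [Group G] (H : Submonoid G) (hq : IsQG H) :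
    [∀ a ∈ H, a ∉ unitSet H → (lengthsOf H a).Finite ∧ (lengthsOf H a).Nonempty,
     (⋂ n : ℕ, ((H : Set G) \ unitSet H) ^ (n + 1)) = ∅,
     ∃ lam : G → ℕ, ∀ a ∈ H,
       ∀ b ∈ (({a} : Set G) * (H : Set G) ∪ (H : Set G) * {a}) \
         (({a} : Set G) * unitSet H ∪ unitSet H * {a}), lam a < lam b].TFAE := by
  tfae_have 1 → 2 := by
    intro h
    refine Set.eq_empty_of_forall_notMem fun a ha => ?_
    rw [Set.mem_iInter] at ha
    have ha0 := nonunitSet_pow_succ_subset 0 (ha 0)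
    obtain ⟨N, hN⟩ := (h a ha0.1 ha0.2).1.bddAbove
    obtain ⟨k, hk, hNk⟩ := exists_le_mem_lengthsOf (fun x hx => (h x hx.1 hx.2).2) (N + 1) (ha N)
    have := hN hk
    omega
  tfae_have 2 → 1 := fun hb a ha hu => ⟨lengthsOf_finite hb a, lengthsOf_nonempty hb ⟨ha, hu⟩⟩
  tfae_have 2 → 3 := fun hb => ⟨nonunitOrder H, isLengthFunction_nonunitOrder hb⟩
  tfae_have 3 → 2 := by
    rintro ⟨lam, hlam⟩
    refine Set.eq_empty_of_forall_notMem fun a ha => ?_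
    rw [Set.mem_iInter] at ha
    have := IsLengthFunction.le_of_mem_pow hlam (lam a + 1) (ha (lam a + 1))
    omega
  tfae_finish
end
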